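/- arXiv:1404.2755 — 3 statements merged into one kernel-verified Lean document; each statement's English description precedes it below -/
import Mathlib

section
/- Let k be a field. There does not exist a proper radical ideal I of k[x,y,z] with rt(I) = 2. Equivalently, there are no reduced affine k-algebras of embedding dimension 3 and relation type 2, and no affine algebraic k-varieties of embedding dimension 3 and relation type 2. -/
open Polynomial MvPolynomial

/-- The kernel of the graded presentation `R[t₁,…,t_s] → 𝐑(I) ⊆ R[X]` of the Rees algebra
of the ideal generated by `f`, sending `tᵢ` to `(f i)·X`. -/
noncomputable def reesKer {R : Type*} [CommRing R] {s : ℕ} (f : Fin s → R) :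
    Ideal (MvPolynomial (Fin s) R) :=
  RingHom.ker (MvPolynomial.aeval
    (fun i => Polynomial.C (f i) * Polynomial.X) : MvPolynomial (Fin s) R →ₐ[R] Polynomial R)

/-- `L` is generated by its homogeneous elements of degree at most `N`. -/
def GenInDegLE {R : Type*} [CommRing R] {s : ℕ}
    (L : Ideal (MvPolynomial (Fin s) R)) (N : ℕ) : Prop :=
  L = Ideal.span {p | p ∈ L ∧ ∃ q ≤ N, MvPolynomial.IsHomogeneous p q}

/-- The relation type of an ideal `I`: the least `N ≥ 1` such that, for every finite
generating family of `I`, the ideal of equations of the corresponding presentation of the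
Rees algebra is generated by its homogeneous elements of degree at most `N`. -/
noncomputable def relType {R : Type*} [CommRing R] (I : Ideal R) : ℕ :=
  sInf {N | 1 ≤ N ∧ ∀ (s : ℕ) (f : Fin s → R),
    Ideal.span (Set.range f) = I → GenInDegLE (reesKer f) N}

/-! ### Alternating matrices and quadratic relations -/

section QuadraticRelations

open Matrix

variable {R : Type*} [CommRing R] {ι κ : Type*} [Fintype ι] [Fintype κ]

/-- A square matrix is alternating if its diagonal vanishes and it is skew-symmetric. -/
def IsAlternating {ι : Type*} (A : Matrix ι ι R) : Prop :=
  (∀ i, A i i = 0) ∧ Aᵀ = -A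

theorem IsAlternating.zero {ι : Type*} : IsAlternating (0 : Matrix ι ι R) :=
  ⟨fun _ => rfl, by simp⟩

theorem IsAlternating.add {ι : Type*} {A B : Matrix ι ι R} (hA : IsAlternating A)
    (hB : IsAlternating B) : IsAlternating (A + B) :=
  ⟨fun i => by simp [hA.1, hB.1], by rw [transpose_add, hA.2, hB.2]; abel⟩

theorem IsAlternating.smul {ι : Type*} {A : Matrix ι ι R} (hA : IsAlternating A) (r : R) :
    IsAlternating (r • A) :=
  ⟨fun i => by simp [hA.1], by rw [transpose_smul, hA.2, smul_neg]⟩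

theorem IsAlternating.neg {ι : Type*} {A : Matrix ι ι R} (hA : IsAlternating A) :
    IsAlternating (-A) := by
  simpa using hA.smul (-1)

theorem IsAlternating.apply_swap {ι : Type*} {A : Matrix ι ι R} (hA : IsAlternating A) (i j : ι) :
    A i j = -A j i := by
  have := congrFun (congrFun hA.2 j) i
  simpa using this

theorem isAlternating_transpose_sub {ι : Type*} (M : Matrix ι ι R) : IsAlternating (Mᵀ - M) :=
  ⟨fun i => by simp, by simp⟩

theorem IsAlternating.dotProduct_mulVec_self {A : Matrix ι ι R} (hA : IsAlternating A)
    (v : ι → R) : v ⬝ᵥ A *ᵥ v = 0 := by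
  classical
  have h : v ⬝ᵥ A *ᵥ v = ∑ p : ι × ι, v p.1 * A p.1 p.2 * v p.2 := by
    simp [dotProduct, mulVec, Finset.mul_sum, Fintype.sum_prod_type, mul_assoc]
  rw [h]
  refine Finset.sum_involution (fun p _ => p.swap) (fun p _ => ?_) (fun p _ hp h => ?_)
    (by simp) (by simp)
  · rw [Prod.fst_swap, Prod.snd_swap, hA.apply_swap p.2 p.1]; ring
  · apply hp
    have : p.2 = p.1 := congrArg Prod.fst h
    rw [this, hA.1]; ring

theorem IsAlternating.mul_mul_transpose {κ : Type*} {A : Matrix ι ι R} (hA : IsAlternating A)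
    (P : Matrix κ ι R) : IsAlternating (P * A * Pᵀ) := by
  refine ⟨fun i => ?_, ?_⟩
  · have := hA.dotProduct_mulVec_self (P i)
    rw [← this, Matrix.mul_assoc]
    simp [Matrix.mul_apply, dotProduct, mulVec]
  · rw [transpose_mul, transpose_mul, hA.2]
    simp [Matrix.mul_assoc]

theorem IsAlternating.vecMul {A : Matrix ι ι R} (hA : IsAlternating A) (v : ι → R) :
    v ᵥ* A = -(A *ᵥ v) := by
  rw [← mulVec_transpose, hA.2, neg_mulVec]

/-- The quadratic forms, represented by matrices, that lie in the ideal generated by the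
linear relations of `f`. -/
def linearSpan (f : ι → R) : Submodule R (Matrix ι ι R) where
  carrier := {M | ∃ N, f ᵥ* N = 0 ∧ IsAlternating (M - N)}
  add_mem' := by
    rintro M M' ⟨N, hN, h⟩ ⟨N', hN', h'⟩
    refine ⟨N + N', by rw [vecMul_add, hN, hN', add_zero], ?_⟩
    rw [add_sub_add_comm]
    exact h.add h'
  zero_mem' := ⟨0, by simp, by simpa using IsAlternating.zero⟩
  smul_mem' := by
    rintro r M ⟨N, hN, h⟩
    refine ⟨r • N, by rw [vecMul_smul, hN, smul_zero], ?_⟩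
    rw [← smul_sub]
    exact h.smul r

theorem mem_linearSpan_of_vecMul_eq_zero {f : ι → R} {M : Matrix ι ι R} (h : f ᵥ* M = 0) :
    M ∈ linearSpan f :=
  ⟨M, h, by simpa using IsAlternating.zero⟩

theorem IsAlternating.mem_linearSpan {f : ι → R} {M : Matrix ι ι R} (h : IsAlternating M) :
    M ∈ linearSpan f :=
  ⟨0, by simp, by simpa using h⟩

theorem mem_linearSpan_of_mulVec_eq_zero {f : ι → R} {M : Matrix ι ι R} (h : M *ᵥ f = 0) :
    M ∈ linearSpan f := by
  refine ⟨Mᵀ, by rw [vecMul_transpose, h], ?_⟩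
  simpa using (isAlternating_transpose_sub M).neg

/-- Every quadratic relation of `f` is a consequence of its linear relations. -/
def QuadraticIsLinear (f : ι → R) : Prop :=
  ∀ M : Matrix ι ι R, f ⬝ᵥ M *ᵥ f = 0 → M ∈ linearSpan f

theorem smul_mem_linearSpan_of_mul {f : ι → R} {f' : κ → R} {h : R} {d : Matrix ι κ R}
    {c : Matrix κ ι R} (hd : d *ᵥ f' = f) (hc : c *ᵥ f = h • f') (hf' : QuadraticIsLinear f')
    {M : Matrix ι ι R} (hM : f ⬝ᵥ M *ᵥ f = 0) : (h * h) • M ∈ linearSpan f := by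
  classical
  obtain ⟨N, hN, hA⟩ := hf' (dᵀ * M * d) (by
    rw [← hM, ← hd]
    simp [← mulVec_mulVec, dotProduct_mulVec, vecMul_transpose])
  set E : Matrix ι ι R := d * c - h • (1 : Matrix ι ι R) with hE
  have hEf : E *ᵥ f = 0 := by
    rw [hE, sub_mulVec, ← mulVec_mulVec, hc, mulVec_smul, hd, smul_mulVec, one_mulVec, sub_self]
  have h1 : (h • (1 : Matrix ι ι R) + E)ᵀ * M * (h • (1 : Matrix ι ι R) + E) ∈ linearSpan f := by
    have : h • (1 : Matrix ι ι R) + E = d * c := by rw [hE]; abel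
    rw [this]
    have e : (d * c)ᵀ * M * (d * c) = cᵀ * N * c + cᵀ * (dᵀ * M * d - N) * c := by
      simp only [transpose_mul, Matrix.mul_sub, Matrix.sub_mul, Matrix.mul_assoc]; abel
    rw [e]
    refine add_mem (mem_linearSpan_of_vecMul_eq_zero ?_) (IsAlternating.mem_linearSpan ?_)
    · rw [← vecMul_vecMul, ← vecMul_vecMul, vecMul_transpose, hc, smul_vecMul, hN, smul_zero,
        zero_vecMul]
    · simpa using hA.mul_mul_transpose cᵀ
  have e : (h * h) • M = (h • (1 : Matrix ι ι R) + E)ᵀ * M * (h • (1 : Matrix ι ι R) + E)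
      - (Eᵀ * (M * (h • (1 : Matrix ι ι R) + E)) + (h • M) * E) := by
    simp only [transpose_add, transpose_smul, transpose_one, Matrix.add_mul, Matrix.mul_add,
      Matrix.smul_mul, Matrix.mul_smul, Matrix.one_mul, Matrix.mul_one, smul_add, mul_smul,
      Matrix.mul_assoc]
    abel
  rw [e]
  refine sub_mem h1 (add_mem (mem_linearSpan_of_vecMul_eq_zero ?_)
    (mem_linearSpan_of_mulVec_eq_zero ?_))
  · rw [← vecMul_vecMul, vecMul_transpose, hEf, zero_vecMul]
  · rw [← mulVec_mulVec, hEf, mulVec_zero]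

theorem exists_mulVec_eq_of_forall_mem_span {κ : Type*} {f : ι → R} {g : κ → R}
    (h : ∀ j, g j ∈ Ideal.span (Set.range f)) : ∃ c : Matrix κ ι R, c *ᵥ f = g := by
  have h' : ∀ j, ∃ c : ι → R, c ⬝ᵥ f = g j := fun j => by
    obtain ⟨c, hc⟩ := (Ideal.mem_span_range_iff_exists_fun).1 (h j)
    exact ⟨c, hc⟩
  choose c hc using h'
  exact ⟨c, funext hc⟩

/-- If `f'` has no essential quadratic relations and `h • (f') ⊆ (f) ⊆ (f')`, then `h²` kills the
essential quadratic relations of `f`. -/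
theorem smul_mem_linearSpan {f : ι → R} {f' : κ → R} {h : R}
    (hle : Ideal.span (Set.range f) ≤ Ideal.span (Set.range f'))
    (hh : ∀ x ∈ Ideal.span (Set.range f'), h * x ∈ Ideal.span (Set.range f))
    (hf' : QuadraticIsLinear f') {M : Matrix ι ι R} (hM : f ⬝ᵥ M *ᵥ f = 0) :
    (h * h) • M ∈ linearSpan f := by
  obtain ⟨d, hd⟩ := exists_mulVec_eq_of_forall_mem_span (f := f') (g := f)
    fun i => hle (Ideal.subset_span ⟨i, rfl⟩)
  obtain ⟨c, hc⟩ := exists_mulVec_eq_of_forall_mem_span (f := f) (g := h • f')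
    fun i => hh _ (Ideal.subset_span ⟨i, rfl⟩)
  exact smul_mem_linearSpan_of_mul hd hc hf' hM

theorem QuadraticIsLinear.of_span_eq {f : ι → R} {f' : κ → R} (hf' : QuadraticIsLinear f')
    (h : Ideal.span (Set.range f) = Ideal.span (Set.range f')) : QuadraticIsLinear f := fun M hM => by
  simpa using smul_mem_linearSpan (h := 1) h.le (by simp [h]) hf' hM

/-- Every quadratic relation of every finite generating family of `I` is a consequence of the
linear ones. -/
def Ideal.QuadraticIsLinear (I : Ideal R) : Prop :=
  ∀ (s : ℕ) (f : Fin s → R), Ideal.span (Set.range f) = I → _root_.QuadraticIsLinear f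

theorem QuadraticIsLinear.ideal {f : ι → R} (hf : QuadraticIsLinear f) :
    (Ideal.span (Set.range f)).QuadraticIsLinear :=
  fun _ _ h => hf.of_span_eq h

/-- The elements that make a quadratic form a consequence of the linear relations. -/
def linearSpanColon (f : ι → R) (M : Matrix ι ι R) : Ideal R :=
  (linearSpan f).comap (LinearMap.toSpanSingleton R _ M)

theorem mem_linearSpanColon {f : ι → R} {M : Matrix ι ι R} {r : R} :
    r ∈ linearSpanColon f M ↔ r • M ∈ linearSpan f := Iff.rfl

end QuadraticRelations

/-! ### Two generated ideals and regular extensions -/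

section Extension

open Matrix

variable {R : Type*} [CommRing R] {ι : Type*} [Fintype ι]

theorem linearSpan_le_smul (c : R) (f : ι → R) : linearSpan f ≤ linearSpan (c • f) := by
  rintro M ⟨N, hN, hA⟩
  exact ⟨N, by rw [smul_vecMul, hN, smul_zero], hA⟩

theorem quadraticIsLinear_pair_of_isRelPrime [IsDomain R] [DecompositionMonoid R] {a b : R}
    (ha : a ≠ 0) (hab : IsRelPrime a b) : QuadraticIsLinear ![a, b] := by
  intro M hM
  have hM' : M 0 0 * a * a + (M 0 1 + M 1 0) * a * b + M 1 1 * b * b = 0 := by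
    simp [dotProduct, mulVec, Fin.sum_univ_two] at hM
    linear_combination hM
  obtain ⟨s, hs⟩ : a ∣ M 1 1 := by
    have : a ∣ M 1 1 * b * b := ⟨-(M 0 0 * a + (M 0 1 + M 1 0) * b), by linear_combination hM'⟩
    exact hab.dvd_of_dvd_mul_right (hab.dvd_of_dvd_mul_right this)
  have h1 : M 0 0 * a + (M 0 1 + M 1 0) * b + s * b * b = 0 := by
    apply mul_left_cancel₀ ha
    rw [mul_zero, ← hM', hs]
    ring
  obtain ⟨r, hr, hr'⟩ : ∃ r, M 0 0 = b * r ∧ r * a + (M 0 1 + M 1 0) + s * b = 0 := by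
    obtain ⟨r, hr⟩ : b ∣ M 0 0 := by
      have : b ∣ M 0 0 * a := ⟨-((M 0 1 + M 1 0) + s * b), by linear_combination h1⟩
      exact hab.symm.dvd_of_dvd_mul_right this
    by_cases hb : b = 0
    · subst hb
      obtain ⟨u, hu⟩ := isRelPrime_zero_right.1 hab
      refine ⟨-(M 0 1 + M 1 0) * ↑u⁻¹, by simp [hr], ?_⟩
      rw [← hu, mul_assoc, Units.inv_mul]
      ring
    · refine ⟨r, hr, ?_⟩
      apply mul_left_cancel₀ hb
      rw [mul_zero, ← h1, hr]
      ring
  refine ⟨!![b * r, -(b * s); -(a * r), a * s], ?_, ?_, ?_⟩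
  · ext j
    fin_cases j <;> simp [vecMul, dotProduct, Fin.sum_univ_two] <;> ring
  · intro i
    fin_cases i <;> simp [hr, hs]
  · ext i j
    fin_cases i <;> fin_cases j <;> simp [hr, hs] <;> linear_combination hr'

theorem quadraticIsLinear_zero : QuadraticIsLinear (0 : ι → R) :=
  fun M _ => mem_linearSpan_of_vecMul_eq_zero (zero_vecMul M)

theorem quadraticIsLinear_pair [IsDomain R] [UniqueFactorizationMonoid R] (a b : R) :
    QuadraticIsLinear ![a, b] := by
  by_cases ha : a = 0
  · by_cases hb : b = 0
    · subst ha hb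
      have : (![0, 0] : Fin 2 → R) = 0 := by ext i; fin_cases i <;> rfl
      rw [this]
      exact quadraticIsLinear_zero
    · refine QuadraticIsLinear.of_span_eq (f' := ![b, a]) ?_ ?_
      · subst ha
        have : (![b, 0] : Fin 2 → R) = b • ![1, 0] := by ext i; fin_cases i <;> simp
        rw [this]
        intro M hM
        refine linearSpan_le_smul b _ (quadraticIsLinear_pair_of_isRelPrime one_ne_zero
          isRelPrime_one_left M ?_)
        have h2 : b * (b * (![1, 0] ⬝ᵥ M *ᵥ ![1, 0])) = 0 := by
          simpa only [mulVec_smul, dotProduct_smul, smul_dotProduct, smul_eq_mul] using hM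
        simpa [hb] using h2
      · simp [Matrix.range_cons, Set.union_comm]
  · obtain ⟨a', b', c, hab, rfl, rfl⟩ := UniqueFactorizationMonoid.exists_reduced_factors a ha b
    have hc : c ≠ 0 := left_ne_zero_of_mul ha
    have : (![c * a', c * b'] : Fin 2 → R) = c • ![a', b'] := by
      ext i; fin_cases i <;> simp
    rw [this]
    intro M hM
    refine linearSpan_le_smul c _ (quadraticIsLinear_pair_of_isRelPrime
      (right_ne_zero_of_mul ha) hab M ?_)
    have h2 : c * (c * (![a', b'] ⬝ᵥ M *ᵥ ![a', b'])) = 0 := by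
      rw [← hM]
      simp only [mulVec_smul, dotProduct_smul, smul_dotProduct, smul_eq_mul]
    simpa [hc] using h2

theorem quadraticIsLinear_singleton [IsDomain R] (c : R) :
    QuadraticIsLinear (fun _ : Unit => c) := by
  intro M hM
  have h : c * (M () () * c) = 0 := by simpa [dotProduct, mulVec] using hM
  apply mem_linearSpan_of_vecMul_eq_zero
  ext j
  have : c = 0 ∨ M () () = 0 := by
    rcases mul_eq_zero.1 h with h | h
    · exact .inl h
    · exact (mul_eq_zero.1 h).symm
  rcases this with h | h <;> simp [vecMul, dotProduct, h]

theorem exists_dotProduct_mulVec_of_mem_sq {f : ι → R} {x : R}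
    (hx : x ∈ Ideal.span (Set.range f) ^ 2) : ∃ P : Matrix ι ι R, f ⬝ᵥ P *ᵥ f = x := by
  rw [pow_two] at hx
  induction hx using Submodule.mul_induction_on' with
  | mem_mul_mem a ha b hb =>
    obtain ⟨u, rfl⟩ := Ideal.mem_span_range_iff_exists_fun.1 ha
    obtain ⟨v, rfl⟩ := Ideal.mem_span_range_iff_exists_fun.1 hb
    refine ⟨vecMulVec u v, ?_⟩
    rw [vecMulVec_mulVec]
    rw [dotProduct_smul, dotProduct_comm f u]
    simp [dotProduct, mul_comm]
  | add a _ b _ ha hb =>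
    obtain ⟨P, rfl⟩ := ha
    obtain ⟨Q, rfl⟩ := hb
    exact ⟨P + Q, by rw [add_mulVec, dotProduct_add]⟩

/-- Adjoining an element that is regular modulo `I` and modulo `I ^ 2`. -/
theorem QuadraticIsLinear.sumElim {f : ι → R} (hf : QuadraticIsLinear f) {c : R}
    (h1 : ∀ r, c * r ∈ Ideal.span (Set.range f) → r ∈ Ideal.span (Set.range f))
    (h2 : ∀ r, c * r ∈ Ideal.span (Set.range f) ^ 2 → r ∈ Ideal.span (Set.range f) ^ 2) :
    QuadraticIsLinear (Sum.elim f fun _ : Unit => c) := by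
  intro M hM
  set M₀ : Matrix ι ι R := M.toBlocks₁₁ with hM₀
  set B : ι → R := fun i => M (.inl i) (.inr ()) with hB
  set C : ι → R := fun j => M (.inr ()) (.inl j) with hC
  set D : R := M (.inr ()) (.inr ()) with hD
  have hQ : f ⬝ᵥ M₀ *ᵥ f + c * (B ⬝ᵥ f) + c * (C ⬝ᵥ f) + c * (c * D) = 0 := by
    rw [← hM]
    simp only [dotProduct, mulVec, Fintype.sum_sum_type, Sum.elim_inl, Sum.elim_inr, hM₀, hB, hC,
      hD, toBlocks₁₁, of_apply, Finset.univ_unique, Finset.sum_singleton, Finset.mul_sum, mul_add,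
      Finset.sum_add_distrib, PUnit.default_eq_unit]
    have : ∀ x, c * (M (Sum.inl x) (Sum.inr ()) * f x) = f x * (M (Sum.inl x) (Sum.inr ()) * c) :=
      fun x => by ring
    simp only [this]
    ring
  have hmem : ∀ v : ι → R, v ⬝ᵥ f ∈ Ideal.span (Set.range f) := fun v =>
    Ideal.mem_span_range_iff_exists_fun.2 ⟨v, rfl⟩
  have hmem' : ∀ P : Matrix ι ι R, f ⬝ᵥ P *ᵥ f ∈ Ideal.span (Set.range f) ^ 2 := fun P => by
    rw [pow_two]
    refine Ideal.sum_mem _ fun i _ => Ideal.mul_mem_mul (Ideal.subset_span ⟨i, rfl⟩) (hmem _)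
  obtain ⟨ρ, hρ⟩ : ∃ ρ : ι → R, ρ ⬝ᵥ f = D := by
    refine Ideal.mem_span_range_iff_exists_fun.1 (h1 _ (h1 _ ?_))
    have : c * (c * D) = -((f ᵥ* M₀) ⬝ᵥ f + c * (B ⬝ᵥ f) + c * (C ⬝ᵥ f)) := by
      rw [← dotProduct_mulVec]
      linear_combination hQ
    rw [this]
    exact neg_mem (add_mem (add_mem (hmem _) (Ideal.mul_mem_left _ _ (hmem _)))
      (Ideal.mul_mem_left _ _ (hmem _)))
  obtain ⟨P, hP⟩ : ∃ P : Matrix ι ι R, f ⬝ᵥ P *ᵥ f = (B + c • ρ + C) ⬝ᵥ f := by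
    refine exists_dotProduct_mulVec_of_mem_sq (h2 _ ?_)
    have : c * ((B + c • ρ + C) ⬝ᵥ f) = -(f ⬝ᵥ M₀ *ᵥ f) := by
      simp only [add_dotProduct, smul_dotProduct, smul_eq_mul, hρ]
      linear_combination hQ
    rw [this]
    exact neg_mem (hmem' _)
  obtain ⟨N, hN, hA⟩ := hf (M₀ + c • P) (by
    rw [add_mulVec, dotProduct_add, smul_mulVec, dotProduct_smul, hP]
    simp only [add_dotProduct, smul_dotProduct, smul_eq_mul, hρ]
    linear_combination hQ)
  refine ⟨fromBlocks (N - c • P) (replicateCol Unit (B + C - f ᵥ* P))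
    (replicateRow Unit (f ᵥ* P)) (of fun _ _ => D), ?_, ?_, ?_⟩
  · ext j
    rcases j with j | j
    · have := congrFun hN j
      simp only [vecMul, dotProduct, Fintype.sum_sum_type, Sum.elim_inl, fromBlocks_apply₁₁,
        Sum.elim_inr, fromBlocks_apply₂₁, replicateRow_apply, Finset.univ_unique,
        Finset.sum_singleton, Pi.zero_apply, Matrix.sub_apply, Matrix.smul_apply, mul_sub, smul_eq_mul,
        Finset.sum_sub_distrib] at this ⊢
      rw [this, Finset.mul_sum]
      simp [mul_left_comm]
    · have e : f ⬝ᵥ (B + C - f ᵥ* P) + c * D = 0 := by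
        have e1 : f ⬝ᵥ f ᵥ* P = f ⬝ᵥ P *ᵥ f := by rw [dotProduct_mulVec, dotProduct_comm]
        rw [dotProduct_sub, e1, hP, dotProduct_comm f]
        simp only [add_dotProduct, smul_dotProduct, smul_eq_mul, hρ]
        ring
      simpa [vecMul, dotProduct] using e
  · rintro (i | i)
    · have := hA.1 i
      simp only [Matrix.sub_apply, Matrix.add_apply, hM₀, toBlocks₁₁, of_apply, fromBlocks_apply₁₁] at this ⊢
      linear_combination this
    · simp [hD]
  · ext i j
    rcases i with i | i <;> rcases j with j | j
    · have := hA.apply_swap j i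
      simp only [Matrix.sub_apply, Matrix.add_apply, hM₀, toBlocks₁₁, of_apply, fromBlocks_apply₁₁,
        transpose_apply, Matrix.neg_apply] at this ⊢
      linear_combination this
    · simp [hB, hC, Subsingleton.elim j ()]
      ring
    · simp [hB, hC, Subsingleton.elim i ()]
      ring
    · simp [hD]

end Extension

/-! ### Maximal ideals of a polynomial ring in three variables -/

section Maximal

theorem Polynomial.Monic.mem_map_C_of_mul_mem {S : Type*} [CommRing S] {q g : S[X]}
    (hq : q.Monic) {n : Ideal S} (h : q * g ∈ n.map Polynomial.C) : g ∈ n.map Polynomial.C := by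
  have key : ∀ x : S[X], x ∈ n.map Polynomial.C ↔ x.map (Ideal.Quotient.mk n) = 0 := fun x => by
    rw [Ideal.mem_map_C_iff, Polynomial.ext_iff]
    simp [Polynomial.coeff_map, Ideal.Quotient.eq_zero_iff_mem]
  rw [key, Polynomial.map_mul] at h
  rw [key]
  exact (hq.map (Ideal.Quotient.mk n)).mul_right_eq_zero_iff.1 h

theorem Polynomial.exists_monic_eq_map_C_sup_span {S : Type*} [CommRing S] [IsJacobsonRing S]
    (m : Ideal S[X]) [hm : m.IsMaximal] : (m.comap Polynomial.C).IsMaximal ∧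
      ∃ q : S[X], q.Monic ∧ m = (m.comap Polynomial.C).map Polynomial.C ⊔ Ideal.span {q} := by
  have hn : (m.comap Polynomial.C).IsMaximal :=
    Polynomial.isMaximal_comap_C_of_isJacobsonRing m
  refine ⟨hn, ?_⟩
  set n := m.comap Polynomial.C with hn'
  let _ := Ideal.Quotient.field n
  set π : S[X] →+* (S ⧸ n)[X] := Polynomial.mapRingHom (Ideal.Quotient.mk n) with hπ
  have hsurj : Function.Surjective π :=
    Polynomial.map_surjective _ Ideal.Quotient.mk_surjective
  have hker : RingHom.ker π = n.map Polynomial.C := by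
    rw [hπ, Polynomial.ker_mapRingHom, Ideal.mk_ker]
  have hnm : n.map Polynomial.C ≤ m := Ideal.map_comap_le
  have hcm : (m.map π).comap π = m := by
    rw [Ideal.comap_map_of_surjective π hsurj, ← RingHom.ker_eq_comap_bot, hker]
    exact sup_eq_left.2 hnm
  obtain ⟨g, hg⟩ := (IsPrincipalIdealRing.principal (m.map π)).principal
  rw [← Ideal.span] at hg
  have hg0 : g ≠ 0 := by
    rintro rfl
    have hbot : m.map π = ⊥ := by rw [hg]; simp
    have : (m.map π).IsMaximal := by
      have := Ideal.map_eq_top_or_isMaximal_of_surjective π hsurj hm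
      exact this.resolve_left (by rw [hbot]; exact bot_ne_top)
    rw [hbot] at this
    exact Polynomial.not_isField (S ⧸ n) (Ring.isField_iff_maximal_bot.2 this)
  obtain ⟨q, hq, -, hqm⟩ := Polynomial.lifts_and_natDegree_eq_and_monic
    (f := Ideal.Quotient.mk n) (p := g * Polynomial.C g.leadingCoeff⁻¹)
    ((Polynomial.mem_lifts _).2 (hsurj _)) (Polynomial.monic_mul_leadingCoeff_inv hg0)
  refine ⟨q, hqm, ?_⟩
  have hspan : m.map π = (Ideal.span {q}).map π := by
    rw [Ideal.map_span, Set.image_singleton, hg]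
    change _ = Ideal.span {Polynomial.map _ q}
    rw [hq]
    refine (Ideal.span_singleton_mul_right_unit ?_ g).symm
    exact Polynomial.isUnit_C.2 (isUnit_iff_ne_zero.2 (by simpa using hg0))
  rw [← hcm, hspan, Ideal.comap_map_of_surjective π hsurj, ← RingHom.ker_eq_comap_bot, hker,
    sup_comm]

theorem Ideal.IsMaximal.quadraticIsLinear {k : Type*} [Field k] (m : Ideal k[X][X][X])
    [m.IsMaximal] : Ideal.QuadraticIsLinear (R := k[X][X][X]) m := by
  obtain ⟨h2, r, hr, hmr⟩ := Polynomial.exists_monic_eq_map_C_sup_span m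
  obtain ⟨h1, q, hq, hmq⟩ := Polynomial.exists_monic_eq_map_C_sup_span (m.comap Polynomial.C)
  obtain ⟨p, hp⟩ := (IsPrincipalIdealRing.principal
    ((m.comap Polynomial.C).comap Polynomial.C)).principal
  rw [← Ideal.span] at hp
  rw [hp, Ideal.map_span, Set.image_singleton] at hmq
  have e1 : Ideal.span (Set.range fun _ : Unit => Polynomial.C (Polynomial.C p)) =
      ((Ideal.span {p}).map Polynomial.C).map Polynomial.C := by
    simp [Ideal.map_span]
  have e2 : Ideal.span (Set.range (Sum.elim (fun _ : Unit => Polynomial.C (Polynomial.C p))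
      fun _ : Unit => Polynomial.C q)) = (m.comap Polynomial.C).map Polynomial.C := by
    rw [hmq, Ideal.map_sup, Ideal.map_span, Ideal.map_span, Set.Sum.elim_range, Ideal.span_union]
    simp
  have e3 : Ideal.span (Set.range (Sum.elim (Sum.elim (fun _ : Unit => Polynomial.C (Polynomial.C p))
      fun _ : Unit => Polynomial.C q) fun _ : Unit => r)) = m := by
    rw [Set.Sum.elim_range, Ideal.span_union, e2]
    conv_rhs => rw [hmr]
    simp
  have hq' : ∀ (n : Ideal k[X]) (g : k[X][X][X]),
      Polynomial.C q * g ∈ (n.map Polynomial.C).map Polynomial.C →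
        g ∈ (n.map Polynomial.C).map Polynomial.C := by
    intro n g hg
    rw [Ideal.mem_map_C_iff] at hg ⊢
    intro i
    have := hg i
    rw [Polynomial.coeff_C_mul] at this
    exact hq.mem_map_C_of_mul_mem this
  rw [← e3]
  refine QuadraticIsLinear.ideal (((quadraticIsLinear_singleton _).sumElim ?_ ?_).sumElim ?_ ?_)
  · rw [e1]
    exact hq' _
  · rw [e1]
    have e : ((((Ideal.span {p}).map Polynomial.C).map Polynomial.C) ^ 2 : Ideal k[X][X][X]) =
        (((Ideal.span {p}) ^ 2).map Polynomial.C).map Polynomial.C := by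
      rw [Ideal.map_pow Polynomial.C, Ideal.map_pow Polynomial.C]
    exact fun g hg => e.ge (hq' _ g (e.le hg))
  · rw [e2]
    exact fun g => hr.mem_map_C_of_mul_mem
  · rw [e2]
    have e := Ideal.map_pow (Polynomial.C : k[X][X] →+* k[X][X][X]) (m.comap Polynomial.C) 2
    exact fun g hg => e.le (hr.mem_map_C_of_mul_mem (e.ge hg))

end Maximal

/-! ### Alternating matrices annihilated by a vector -/

section AlternatingSyzygies

open Matrix

variable {R : Type*} [CommRing R] {ι : Type*} [Fintype ι]

theorem mem_ker_linearCombination {f v : ι → R} :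
    v ∈ LinearMap.ker (Fintype.linearCombination R f) ↔ f ⬝ᵥ v = 0 := by
  simp [Fintype.linearCombination_apply, dotProduct, mul_comm]

theorem exists_smul_eq_sum_ker_linearCombination [IsDomain R] (f : ι → R) :
    ∃ d : R, d ≠ 0 ∧ ∃ u : ι → LinearMap.ker (Fintype.linearCombination R f),
      ∀ z : LinearMap.ker (Fintype.linearCombination R f), d • z = ∑ i, z.1 i • u i := by
  classical
  by_cases hf : f = 0
  · refine ⟨1, one_ne_zero, fun i => ⟨Pi.single i 1, ?_⟩, fun z => ?_⟩
    · rw [mem_ker_linearCombination, hf, zero_dotProduct]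
    · ext j
      simp [Finset.sum_apply, Pi.single_apply]
  · obtain ⟨i₀, hi₀⟩ := Function.ne_iff.1 hf
    refine ⟨f i₀, hi₀, fun i => ⟨f i₀ • Pi.single i 1 - f i • Pi.single i₀ 1, ?_⟩, fun z => ?_⟩
    · rw [mem_ker_linearCombination]
      simp [dotProduct_sub, dotProduct_smul, mul_comm]
    · have hz := mem_ker_linearCombination.1 z.2
      ext j
      have e : ∑ i, z.1 i * f i * (Pi.single i₀ 1 : ι → R) j = 0 := by
        rw [← Finset.sum_mul]
        simp only [dotProduct] at hz
        simp [mul_comm, hz]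
      simp [Finset.sum_apply, Pi.single_apply, mul_sub] at e ⊢
      by_cases hj : j = i₀ <;> simp [hj] at e ⊢ <;> grind

/-- The alternating matrices annihilated by `f` come from the second exterior power of the syzygy
module of `f`. -/
def HasAlternatingSyzygies (f : ι → R) : Prop :=
  ∀ A : Matrix ι ι R, IsAlternating A → f ᵥ* A = 0 →
    ∃ (n : ℕ) (P : Matrix ι (Fin n) R) (C : Matrix (Fin n) (Fin n) R),
      f ᵥ* P = 0 ∧ IsAlternating C ∧ A = P * C * Pᵀ

theorem hasAlternatingSyzygies [IsDomain R] [IsNoetherianRing R] (f : ι → R)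
    [Module.Projective R (LinearMap.ker (Fintype.linearCombination R f))] :
    HasAlternatingSyzygies f := by
  classical
  intro A hA hfA
  obtain ⟨n, g, hg⟩ :=
    Module.Finite.exists_fin' R (LinearMap.ker (Fintype.linearCombination R f))
  obtain ⟨h, hh⟩ := Module.projective_lifting_property g LinearMap.id hg
  have hAf : A *ᵥ f = 0 := by
    have := hA.vecMul f
    rw [hfA] at this
    simpa using this.symm
  set P : Matrix ι (Fin n) R := of fun i j => (g (Pi.single j 1)).1 i with hP
  have hgP : ∀ c, (g c).1 = P *ᵥ c := fun c => by
    ext i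
    have hc : c = ∑ j, c j • (Pi.single j 1 : Fin n → R) := by
      ext i; simp [Finset.sum_apply, Pi.single_apply]
    conv_lhs => rw [hc]
    simp [hP, mulVec, dotProduct, Finset.sum_apply, mul_comm]
  have hz : ∀ z : LinearMap.ker (Fintype.linearCombination R f), P *ᵥ h z = z.1 := fun z => by
    rw [← hgP]
    exact congrArg Subtype.val (LinearMap.congr_fun hh z)
  have hcol : ∀ j, (fun i => A i j) ∈ LinearMap.ker (Fintype.linearCombination R f) := fun j => by
    rw [mem_ker_linearCombination]
    exact congrFun hfA j
  set H : Matrix (Fin n) ι R := of fun l j => h ⟨_, hcol j⟩ l with hH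
  have hAH : A = P * H := by
    ext i j
    exact (congrFun (hz ⟨_, hcol j⟩) i).symm
  have hrow : ∀ l, H l ∈ LinearMap.ker (Fintype.linearCombination R f) := fun l => by
    rw [mem_ker_linearCombination]
    have e : ∑ j, f j • (⟨_, hcol j⟩ : LinearMap.ker (Fintype.linearCombination R f)) = 0 := by
      ext i
      have := congrFun hAf i
      simpa [mulVec, dotProduct, mul_comm, Finset.sum_apply] using this
    have := congrArg h e
    rw [map_sum, map_zero] at this
    simp only [map_smul] at this
    simpa [Finset.sum_apply, dotProduct, hH] using congrFun this l
  set C : Matrix (Fin n) (Fin n) R := of fun l l' => h ⟨_, hrow l⟩ l' with hC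
  have hHC : H = C * Pᵀ := by
    ext l j
    refine (congrFun (hz ⟨_, hrow l⟩) j).symm.trans ?_
    simp [Matrix.mul_apply, mulVec, dotProduct, hC, mul_comm]
  have hPf : f ᵥ* P = 0 := by
    ext j
    exact mem_ker_linearCombination.1 (g (Pi.single j 1)).2
  refine ⟨n, P, C, hPf, ?_, by rw [Matrix.mul_assoc, ← hHC, hAH]⟩
  obtain ⟨d, hd, u, hu⟩ := exists_smul_eq_sum_ker_linearCombination f
  set Y : Matrix (Fin n) ι R := of fun l i => h (u i) l with hY
  have hYz : ∀ z : LinearMap.ker (Fintype.linearCombination R f), d • h z = Y *ᵥ z.1 := fun z => by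
    rw [← map_smul, hu]
    ext l
    simp [mulVec, dotProduct, hY, Finset.sum_apply, mul_comm]
  have h1 : d • H = Y * A := by
    ext l j
    exact congrFun (hYz ⟨_, hcol j⟩) l
  have h2 : d • C = H * Yᵀ := by
    ext l l'
    refine (congrFun (hYz ⟨_, hrow l⟩) l').trans ?_
    simp [Matrix.mul_apply, mulVec, dotProduct, mul_comm]
  have h3 : (d * d) • C = Y * A * Yᵀ := by
    rw [mul_smul, h2, ← Matrix.smul_mul, h1]
  have h4 := h3 ▸ hA.mul_mul_transpose Y
  refine ⟨fun i => ?_, ?_⟩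
  · have := h4.1 i
    simpa [hd] using this
  · have := h4.2
    rw [transpose_smul, ← smul_neg] at this
    exact smul_right_injective _ (mul_ne_zero hd hd) this

/-- Cancelling a scalar modulo which the alternating syzygies are decomposable. -/
theorem mem_linearSpan_of_smul_mem {R' : Type*} [CommRing R'] (π : R →+* R')
    (hπ : Function.Surjective π) {a : R} (ha : a ∈ nonZeroDivisors R)
    (hker : RingHom.ker π = Ideal.span {a}) {f : ι → R} (hf : HasAlternatingSyzygies (π ∘ f))
    (hI : ∀ r, a * r ∈ Ideal.span (Set.range f) → r ∈ Ideal.span (Set.range f))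
    {U : Matrix ι ι R} (hU : a • U ∈ linearSpan f) : U ∈ linearSpan f := by
  classical
  have ha' : ∀ {x y : R}, a * x = a * y → x = y := fun {x y} h =>
    (mul_cancel_left_mem_nonZeroDivisors ha).1 h
  have hπa : π a = 0 := by
    rw [← RingHom.mem_ker, hker]; exact Ideal.mem_span_singleton_self a
  have hπ0 : ∀ x, π x = 0 → ∃ y, x = a * y := fun x hx => by
    rw [← RingHom.mem_ker, hker] at hx
    exact Ideal.mem_span_singleton.1 hx
  obtain ⟨M, hM, hE⟩ := hU
  set E := a • U - M with hEdef
  have hmap : M.map π = -(E.map π) := by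
    ext i j
    simp [hEdef, hπa]
  obtain ⟨n, P', C', hP', hC', hMP⟩ := hf (M.map π) (by
    rw [hmap]
    refine IsAlternating.neg ⟨fun i => ?_, ?_⟩
    · simp [hE.1 i]
    · ext i j
      simp [hE.apply_swap j i]) (by
    ext j
    have := congrArg π (congrFun hM j)
    simpa [vecMul, dotProduct] using this)
  have hlift : ∀ j : Fin n, ∃ v : ι → R, f ⬝ᵥ v = 0 ∧ ∀ i, π (v i) = P' i j := fun j => by
    choose v hv using fun i => hπ (P' i j)
    obtain ⟨r, hr⟩ := hπ0 (f ⬝ᵥ v) (by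
      have := congrFun hP' j
      simpa [vecMul, dotProduct, hv] using this)
    obtain ⟨w, hw⟩ := Ideal.mem_span_range_iff_exists_fun.1 (hI r (by
      rw [← hr, dotProduct_comm]
      exact Ideal.mem_span_range_iff_exists_fun.2 ⟨v, rfl⟩))
    refine ⟨v - a • w, ?_, fun i => by simp [hv, hπa]⟩
    rw [dotProduct_sub, hr, dotProduct_smul, dotProduct_comm, ← hw]
    simp [dotProduct]
  choose v hv hvP using hlift
  set P : Matrix ι (Fin n) R := of fun i j => v j i with hP
  obtain ⟨C, hC, hCC⟩ : ∃ C : Matrix (Fin n) (Fin n) R, IsAlternating C ∧ C.map π = C' := by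
    choose c hc using fun i j => hπ (C' i j)
    refine ⟨of fun i j => if i < j then c i j else if j < i then -c j i else 0, ⟨?_, ?_⟩, ?_⟩
    · simp
    · ext i j
      rcases lt_trichotomy i j with h | rfl | h
      · simp [h, h.not_gt]
      · simp
      · simp [h, h.not_gt]
    · ext i j
      rcases lt_trichotomy i j with h | rfl | h
      · simp [h, hc]
      · simp [hC'.1]
      · simp [h, h.not_gt, hc, hC'.apply_swap i j]
  have hPmap : P.map π = P' := by
    ext i j; exact hvP j i
  have hfP : f ᵥ* P = 0 := by
    ext j; exact hv j
  have hdiff : ∀ i j, ∃ y, (M - P * C * Pᵀ) i j = a * y := fun i j => by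
    apply hπ0
    have e : (M - P * C * Pᵀ).map π = 0 := by
      rw [Matrix.map_sub _ (map_sub π), Matrix.map_mul, Matrix.map_mul, hMP, hPmap, hCC,
        transpose_map, hPmap, sub_self]
    exact congrFun (congrFun e i) j
  choose N hN using hdiff
  have hN' : M - P * C * Pᵀ = a • (of N) := by
    ext i j; exact hN i j
  refine ⟨of N, ?_, ?_⟩
  · ext j
    apply ha'
    have e : f ᵥ* (a • of N) = 0 := by
      rw [← hN', vecMul_sub, hM, ← vecMul_vecMul, ← vecMul_vecMul, hfP]
      simp
    rw [vecMul_smul] at e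
    simpa using congrFun e j
  · have e : a • (U - of N) = P * C * Pᵀ + E := by
      rw [smul_sub, ← hN', hEdef]; abel
    have h4 := (hC.mul_mul_transpose P).add hE
    rw [← e] at h4
    refine ⟨fun i => ?_, ?_⟩
    · apply ha'
      simpa using h4.1 i
    · ext i j
      apply ha'
      have := congrFun (congrFun h4.2 i) j
      simp only [transpose_apply, Matrix.neg_apply, Matrix.smul_apply, smul_eq_mul] at this ⊢
      rw [this, mul_neg]

end AlternatingSyzygies

/-! ### Projectivity of second syzygies over a polynomial ring -/

section Projective

open TensorProduct

variable {A M : Type*} [CommRing A] [AddCommGroup M] [Module A M] [Module A[X] M]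
  [IsScalarTower A A[X] M]

/-- The characteristic map `1 ⊗ m ↦ X ⊗ m - 1 ⊗ X m` of an `A[X]`-module `M`. -/
noncomputable def Polynomial.charMap (A M : Type*) [CommRing A] [AddCommGroup M] [Module A M]
    [Module A[X] M] [IsScalarTower A A[X] M] : A[X] ⊗[A] M →ₗ[A[X]] A[X] ⊗[A] M :=
  LinearMap.lsmul A[X] _ Polynomial.X -
    ((Module.toModuleEnd A (S := A[X]) M Polynomial.X : M →ₗ[A] M).baseChange A[X])

theorem Polynomial.charMap_tmul (p : A[X]) (m : M) :
    Polynomial.charMap A M (p ⊗ₜ m) = (Polynomial.X * p) ⊗ₜ m - p ⊗ₜ ((Polynomial.X : A[X]) • m) :=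
  rfl

/-- The action map `p ⊗ m ↦ p m`. -/
noncomputable def Polynomial.actionMap (A M : Type*) [CommRing A] [AddCommGroup M] [Module A M]
    [Module A[X] M] [IsScalarTower A A[X] M] : A[X] ⊗[A] M →ₗ[A[X]] M :=
  TensorProduct.AlgebraTensorModule.lift
    ((LinearMap.lsmul A[X] (M →ₗ[A] M)).flip LinearMap.id)

theorem Polynomial.actionMap_tmul (p : A[X]) (m : M) :
    Polynomial.actionMap A M (p ⊗ₜ m) = p • m := rfl

theorem Polynomial.actionMap_charMap (t : A[X] ⊗[A] M) :
    Polynomial.actionMap A M (Polynomial.charMap A M t) = 0 := by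
  induction t with
  | zero => simp
  | add x y hx hy => simp [hx, hy]
  | tmul p m =>
    rw [charMap_tmul, map_sub, actionMap_tmul, actionMap_tmul, smul_smul, mul_comm, sub_self]

theorem Polynomial.exists_charMap_eq (t : A[X] ⊗[A] M) :
    ∃ s, Polynomial.charMap A M s = t - 1 ⊗ₜ Polynomial.actionMap A M t := by
  suffices h : ∀ (n : ℕ) (m : M), ∃ s, Polynomial.charMap A M s =
      ((Polynomial.X : A[X]) ^ n) ⊗ₜ m - 1 ⊗ₜ (((Polynomial.X : A[X]) ^ n) • m) by
    induction t with
    | zero => exact ⟨0, by simp⟩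
    | add x y hx hy =>
      obtain ⟨s, hs⟩ := hx
      obtain ⟨s', hs'⟩ := hy
      exact ⟨s + s', by rw [map_add, hs, hs', map_add, tmul_add]; abel⟩
    | tmul p m =>
      rw [actionMap_tmul]
      induction p using Polynomial.induction_on' with
      | add p q hp hq =>
        obtain ⟨s, hs⟩ := hp
        obtain ⟨s', hs'⟩ := hq
        exact ⟨s + s', by rw [map_add, hs, hs', add_tmul, add_smul, tmul_add]; abel⟩
      | monomial n a =>
        obtain ⟨s, hs⟩ := h n (a • m)
        refine ⟨s, ?_⟩
        rw [hs, ← Polynomial.smul_X_eq_monomial, smul_assoc, smul_tmul, smul_comm]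
  intro n
  induction n with
  | zero => exact fun m => ⟨0, by simp⟩
  | succ n ih =>
    intro m
    obtain ⟨s, hs⟩ := ih ((Polynomial.X : A[X]) • m)
    refine ⟨s + (Polynomial.X ^ n) ⊗ₜ m, ?_⟩
    rw [map_add, hs, charMap_tmul, smul_smul, ← pow_succ, ← pow_succ']
    abel

/-- The coefficient maps `A[X] ⊗ M → M`. -/
noncomputable def Polynomial.tensorCoeff (A M : Type*) [CommRing A] [AddCommGroup M] [Module A M]
    (n : ℕ) : A[X] ⊗[A] M →ₗ[A] M :=
  TensorProduct.lift ((LinearMap.lsmul A M).comp (Polynomial.lcoeff A n))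

theorem Polynomial.tensorCoeff_tmul {A M : Type*} [CommRing A] [AddCommGroup M] [Module A M] (n : ℕ) (p : A[X]) (m : M) :
    Polynomial.tensorCoeff A M n (p ⊗ₜ m) = p.coeff n • m := rfl

theorem Polynomial.tensorCoeff_succ_charMap (n : ℕ) (t : A[X] ⊗[A] M) :
    Polynomial.tensorCoeff A M (n + 1) (Polynomial.charMap A M t) =
      Polynomial.tensorCoeff A M n t -
        (Polynomial.X : A[X]) • Polynomial.tensorCoeff A M (n + 1) t := by
  induction t with
  | zero => simp
  | add x y hx hy => simp only [map_add, hx, hy, smul_add]; abel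
  | tmul p m =>
    rw [charMap_tmul, map_sub, tensorCoeff_tmul, tensorCoeff_tmul, tensorCoeff_tmul,
      tensorCoeff_tmul, Polynomial.coeff_X_mul, smul_comm]

theorem Polynomial.exists_eq_sum_tensorCoeff {A M : Type*} [CommRing A] [AddCommGroup M]
    [Module A M] (t : A[X] ⊗[A] M) :
    ∃ N, ∀ n ≥ N, Polynomial.tensorCoeff A M n t = 0 ∧
      t = ∑ i ∈ Finset.range n, ((Polynomial.X : A[X]) ^ i) ⊗ₜ Polynomial.tensorCoeff A M i t := by
  induction t with
  | zero => exact ⟨0, fun n _ => by simp⟩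
  | add x y hx hy =>
    obtain ⟨N, hN⟩ := hx
    obtain ⟨N', hN'⟩ := hy
    refine ⟨max N N', fun n hn => ?_⟩
    obtain ⟨h1, h2⟩ := hN n (le_trans (le_max_left _ _) hn)
    obtain ⟨h1', h2'⟩ := hN' n (le_trans (le_max_right _ _) hn)
    refine ⟨by rw [map_add, h1, h1', add_zero], ?_⟩
    simp only [map_add, tmul_add, Finset.sum_add_distrib]
    rw [← h2, ← h2']
  | tmul p m =>
    refine ⟨p.natDegree + 1, fun n hn => ⟨?_, ?_⟩⟩
    · rw [tensorCoeff_tmul, Polynomial.coeff_eq_zero_of_natDegree_lt (by omega), zero_smul]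
    · conv_lhs => rw [p.as_sum_range' n (by omega), sum_tmul]
      refine Finset.sum_congr rfl fun i _ => ?_
      rw [tensorCoeff_tmul, ← Polynomial.smul_X_eq_monomial, smul_tmul]

theorem Polynomial.charMap_injective : Function.Injective (Polynomial.charMap A M) := by
  rw [injective_iff_map_eq_zero]
  intro t ht
  obtain ⟨N, hN⟩ := exists_eq_sum_tensorCoeff t
  have hstep : ∀ n, Polynomial.tensorCoeff A M (n + 1) t = 0 →
      Polynomial.tensorCoeff A M n t = 0 := fun n hn => by
    have := tensorCoeff_succ_charMap n t
    rw [ht, hn, map_zero, smul_zero, sub_zero] at this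
    exact this.symm
  have hall : ∀ n, n ≤ N → Polynomial.tensorCoeff A M n t = 0 := fun n hn =>
    Nat.decreasingInduction (motive := fun n _ => Polynomial.tensorCoeff A M n t = 0)
      (fun n _ => hstep n) (hN N le_rfl).1 hn
  rw [(hN N le_rfl).2]
  refine Finset.sum_eq_zero fun i hi => ?_
  rw [hall i (Finset.mem_range.1 hi).le, tmul_zero]

/-- If `M` is an `A[X]`-module that is projective over `A`, then the kernel of every surjection
from a projective `A[X]`-module to `M` is projective. -/
theorem Polynomial.projective_ker [Module.Projective A M] {P : Type*} [AddCommGroup P]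
    [Module A[X] P] [Module.Projective A[X] P] (f : P →ₗ[A[X]] M) (hf : Function.Surjective f) :
    Module.Projective A[X] (LinearMap.ker f) := by
  let _ : Module A P := Module.compHom P (algebraMap A A[X])
  have : IsScalarTower A A[X] P := IsScalarTower.of_algebraMap_smul fun _ _ => rfl
  obtain ⟨σ, hσ⟩ := Module.projective_lifting_property (f.restrictScalars A) LinearMap.id hf
  have hσ' : ∀ m, f (σ m) = m := fun m => LinearMap.congr_fun hσ m
  set act := Polynomial.actionMap A M with hact
  set j := Polynomial.charMap A M with hj
  set lam : A[X] ⊗[A] M →ₗ[A[X]] P := (Polynomial.actionMap A P).comp (σ.baseChange A[X])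
  have hlam : ∀ t, f (lam t) = act t := fun t => by
    induction t with
    | zero => simp
    | add x y hx hy => simp [hx, hy]
    | tmul p m => simp [lam, actionMap_tmul, hact, hσ']
  have hact_surj : Function.Surjective act := fun m => ⟨1 ⊗ₜ m, by simp [hact, actionMap_tmul]⟩
  obtain ⟨μ, hμ⟩ := Module.projective_lifting_property act f hact_surj
  have hμ' : ∀ v, act (μ v) = f v := fun v => LinearMap.congr_fun hμ v
  set e := LinearEquiv.ofInjective j charMap_injective with he
  have hmem : ∀ v : LinearMap.ker f, μ v ∈ LinearMap.range j := fun v => by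
    obtain ⟨s, hs⟩ := exists_charMap_eq (μ v)
    refine ⟨s, ?_⟩
    rw [← hj] at hs
    rw [hs, ← hact, hμ', LinearMap.mem_ker.1 v.2, tmul_zero, sub_zero]
  set ν : LinearMap.ker f →ₗ[A[X]] A[X] ⊗[A] M :=
    e.symm.toLinearMap.comp ((μ.comp (LinearMap.ker f).subtype).codRestrict _ hmem) with hν
  have hjν : ∀ v, j (ν v) = μ v := fun v => by
    have := LinearEquiv.apply_symm_apply e ⟨μ v, hmem v⟩
    exact congrArg Subtype.val this
  have hker : ∀ x, ((LinearMap.id - lam.comp μ).coprod (lam.comp j)) x ∈ LinearMap.ker f := by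
    rintro ⟨v, t⟩
    rw [LinearMap.mem_ker]
    simp only [LinearMap.coprod_apply, LinearMap.sub_apply, LinearMap.id_apply,
      LinearMap.comp_apply, map_add, map_sub, hlam, hμ', sub_self, zero_add]
    exact actionMap_charMap t
  refine Module.Projective.of_split ((LinearMap.ker f).subtype.prod ν)
    (((LinearMap.id - lam.comp μ).coprod (lam.comp j)).codRestrict (LinearMap.ker f) hker) ?_
  ext v
  simp [hjν]

/-- Over `K[X]`, every submodule of a projective module is projective. -/
theorem Polynomial.projective_submodule {K P : Type*} [Field K] [AddCommGroup P] [Module K[X] P]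
    [Module.Projective K[X] P] (N : Submodule K[X] P) : Module.Projective K[X] N := by
  let _ : Module K (P ⧸ N) := Module.compHom _ (algebraMap K K[X])
  have : IsScalarTower K K[X] (P ⧸ N) := IsScalarTower.of_algebraMap_smul fun _ _ => rfl
  have := Polynomial.projective_ker N.mkQ N.mkQ_surjective
  rwa [Submodule.ker_mkQ] at this

/-- Second syzygies over `K[X][Y]` are projective. -/
theorem Polynomial.projective_ker_of_field {K P : Type*} [Field K] [AddCommGroup P]
    [Module K[X][X] P] [Module.Projective K[X][X] P] (f : P →ₗ[K[X][X]] K[X][X]) :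
    Module.Projective K[X][X] (LinearMap.ker f) := by
  have : Module.Projective K[X] (LinearMap.range f) :=
    Polynomial.projective_submodule ((LinearMap.range f).restrictScalars K[X])
  have := Polynomial.projective_ker (A := K[X]) (M := LinearMap.range f) f.rangeRestrict f.surjective_rangeRestrict
  rwa [LinearMap.ker_rangeRestrict] at this

end Projective

/-! ### Radical ideals of `S[X]`, for `S` a principal ideal domain -/

section TwoGenerators

theorem Polynomial.exists_eq_span_pair_of_squarefree {S : Type*} [CommRing S] [IsDomain S]
    [IsPrincipalIdealRing S] (p : S) (hp : Squarefree p) (hp0 : p ≠ 0) (J : Ideal S[X])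
    (hJ : Polynomial.C p ∈ J) : ∃ q, J = Ideal.span {Polynomial.C p, q} := by
  induction p using WfDvdMonoid.induction_on_irreducible generalizing J with
  | zero => exact absurd rfl hp0
  | unit u hu =>
    refine ⟨0, le_antisymm (fun x _ => ?_) (Ideal.span_le.2 ?_)⟩
    · have : Ideal.span {Polynomial.C u, 0} = ⊤ :=
        Ideal.eq_top_of_isUnit_mem _ (Ideal.subset_span (Set.mem_insert _ _))
          (Polynomial.isUnit_C.2 hu)
      rw [this]
      trivial
    · rintro x (rfl | rfl)
      exacts [hJ, J.zero_mem]
  | mul a i ha hi ih =>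
    have hcop : IsCoprime i a := by
      refine (hi.isCoprime_or_dvd a).resolve_right fun ⟨b, hb⟩ => hi.not_isUnit (hp i ⟨b, ?_⟩)
      rw [hb, mul_assoc]
    obtain ⟨u, v, huv⟩ := hcop
    have huv' : Polynomial.C u * Polynomial.C i + Polynomial.C v * Polynomial.C a = 1 := by
      rw [← Polynomial.C_mul, ← Polynomial.C_mul, ← Polynomial.C_add, huv, Polynomial.C_1]
    rw [Polynomial.C_mul] at hJ
    obtain ⟨q₁, hq₁⟩ : ∃ q, J ⊔ Ideal.span {Polynomial.C i} = Ideal.span {Polynomial.C i, q} := by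
      have : (Ideal.span {i}).IsMaximal := PrincipalIdealRing.isMaximal_of_irreducible hi
      let _ := Ideal.Quotient.field (Ideal.span {i})
      set π : S[X] →+* (S ⧸ Ideal.span {i})[X] :=
        Polynomial.mapRingHom (Ideal.Quotient.mk _) with hπ
      have hsurj : Function.Surjective π :=
        Polynomial.map_surjective _ Ideal.Quotient.mk_surjective
      have hker : RingHom.ker π = Ideal.span {Polynomial.C i} := by
        rw [hπ, Polynomial.ker_mapRingHom, Ideal.mk_ker, Ideal.map_span, Set.image_singleton]
      obtain ⟨g, hg⟩ := (IsPrincipalIdealRing.principal (J.map π)).principal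
      obtain ⟨q, rfl⟩ := hsurj g
      have hspan : J.map π = (Ideal.span {q}).map π := by
        rw [Ideal.map_span, Set.image_singleton]
        exact hg
      refine ⟨q, ?_⟩
      have e := congrArg (Ideal.comap π) hspan
      rw [Ideal.comap_map_of_surjective π hsurj, Ideal.comap_map_of_surjective π hsurj,
        ← RingHom.ker_eq_comap_bot, hker] at e
      rw [e, sup_comm, ← Ideal.span_union, Set.singleton_union]
    obtain ⟨q₂, hq₂⟩ := ih (hp.squarefree_of_dvd (dvd_mul_left _ _)) ha
      (J ⊔ Ideal.span {Polynomial.C a})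
      (Ideal.mem_sup_right (Ideal.mem_span_singleton_self _))
    refine ⟨Polynomial.C u * Polynomial.C i * q₂ + Polynomial.C v * Polynomial.C a * q₁,
      le_antisymm (fun x hx => ?_) (Ideal.span_le.2 ?_)⟩
    · have hx1 : x ∈ Ideal.span {Polynomial.C i, q₁} := hq₁ ▸ Ideal.mem_sup_left hx
      have hx2 : x ∈ Ideal.span {Polynomial.C a, q₂} := hq₂ ▸ Ideal.mem_sup_left hx
      rw [Ideal.mem_span_pair] at hx1 hx2 ⊢
      obtain ⟨r, s, h1⟩ := hx1
      obtain ⟨r', s', h2⟩ := hx2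
      rw [Polynomial.C_mul]
      set ci := Polynomial.C i
      set ca := Polynomial.C a
      set cu := Polynomial.C u
      set cv := Polynomial.C v
      refine ⟨cu * r' + cv * r + cu * cv * (q₂ * s' + q₁ * s - q₂ * s - q₁ * s'),
        cu * ci * s' + cv * ca * s, ?_⟩
      linear_combination (x + cu * ci * q₂ * s' + cv * ca * q₁ * s) * huv' + cu * ci * h2 +
        cv * ca * h1
    · have h1 : q₁ ∈ J ⊔ Ideal.span {Polynomial.C i} :=
        hq₁ ▸ Ideal.subset_span (Set.mem_insert_of_mem _ rfl)
      have h2 : q₂ ∈ J ⊔ Ideal.span {Polynomial.C a} :=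
        hq₂ ▸ Ideal.subset_span (Set.mem_insert_of_mem _ rfl)
      obtain ⟨y, hy, z, hz, h1⟩ := Submodule.mem_sup.1 h1
      obtain ⟨y', hy', z', hz', h2⟩ := Submodule.mem_sup.1 h2
      obtain ⟨z, rfl⟩ := Ideal.mem_span_singleton'.1 hz
      obtain ⟨z', rfl⟩ := Ideal.mem_span_singleton'.1 hz'
      rintro x (rfl | rfl)
      · rwa [Polynomial.C_mul]
      · rw [← h1, ← h2]
        have e : Polynomial.C u * Polynomial.C i * (y' + z' * Polynomial.C a) +
            Polynomial.C v * Polynomial.C a * (y + z * Polynomial.C i) =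
            (Polynomial.C u * Polynomial.C i) * y' + (Polynomial.C v * Polynomial.C a) * y +
            (Polynomial.C u * z' + Polynomial.C v * z) * (Polynomial.C i * Polynomial.C a) := by
          ring
        rw [e]
        exact add_mem (add_mem (J.mul_mem_left _ hy') (J.mul_mem_left _ hy))
          (J.mul_mem_left _ hJ)

attribute [local instance] Polynomial.algebra Polynomial.isLocalization

theorem Ideal.IsRadical.exists_eq_span_pair {S : Type*} [CommRing S] [IsDomain S]
    [IsPrincipalIdealRing S] (I : Ideal S[X]) (hI : I.IsRadical) :
    ∃ a b, I = Ideal.span {a, b} := by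
  classical
  by_cases hI0 : I = ⊥
  · exact ⟨0, 0, by simp [hI0]⟩
  let _ : NormalizedGCDMonoid S := Classical.choice inferInstance
  set F := FractionRing S
  have hinj : Function.Injective (Polynomial.map (algebraMap S F)) :=
    Polynomial.map_injective _ (IsFractionRing.injective S F)
  obtain ⟨g', hg'⟩ := (IsPrincipalIdealRing.principal (I.map (algebraMap S[X] F[X]))).principal
  rw [← Ideal.span] at hg'
  have hmem : ∀ x ∈ I, g' ∣ x.map (algebraMap S F) := fun x hx => by
    rw [← Ideal.mem_span_singleton, ← hg']
    exact Ideal.mem_map_of_mem (algebraMap S[X] F[X]) hx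
  have hg'0 : g' ≠ 0 := by
    rintro rfl
    refine hI0 (eq_bot_iff.2 fun x hx => ?_)
    have := zero_dvd_iff.1 (hmem x hx)
    exact hinj (by simpa using this)
  obtain ⟨b, hb, hbg⟩ := IsLocalization.integerNormalization_spec (nonZeroDivisors S) g'
  set g₁ := IsLocalization.integerNormalization (nonZeroDivisors S) g' with hg₁
  have hb' : algebraMap S F b ≠ 0 := IsFractionRing.to_map_ne_zero_of_mem_nonZeroDivisors hb
  have hbg' : g₁.map (algebraMap S F) = Polynomial.C (algebraMap S F b) * g' := by
    rw [hbg, Algebra.smul_def, IsScalarTower.algebraMap_apply S F F[X]]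
    rfl
  have hg₁0 : g₁ ≠ 0 := by
    intro h
    rw [h, Polynomial.map_zero] at hbg'
    exact mul_ne_zero (Polynomial.C_ne_zero.2 hb') hg'0 hbg'.symm
  set g := g₁.primPart with hg
  have hgprim : g.IsPrimitive := g₁.isPrimitive_primPart
  have hg0 : g ≠ 0 := hgprim.ne_zero
  have hgdvd : ∀ x ∈ I, g ∣ x := fun x hx => by
    refine hgprim.dvd_of_fraction_map_dvd_fraction_map (K := F) ?_
    have h1 : g.map (algebraMap S F) ∣ g₁.map (algebraMap S F) :=
      Polynomial.map_dvd _ (Polynomial.primPart_dvd g₁)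
    refine h1.trans ?_
    rw [hbg']
    exact ((Polynomial.isUnit_C.2 (isUnit_iff_ne_zero.2 hb')).mul_left_dvd).2 (hmem x hx)
  obtain ⟨d, hd, hdg⟩ : ∃ d : S, d ≠ 0 ∧ Polynomial.C d * g ∈ I := by
    have h1 : algebraMap S[X] F[X] g₁ ∈ I.map (algebraMap S[X] F[X]) := by
      rw [hg', Ideal.mem_span_singleton]
      exact ⟨Polynomial.C (algebraMap S F b), (hbg'.trans (mul_comm _ _))⟩
    obtain ⟨_, ⟨c, hc, rfl⟩, hcg⟩ := (IsLocalization.algebraMap_mem_map_algebraMap_iff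
      ((nonZeroDivisors S).map Polynomial.C) F[X] I g₁).1 h1
    refine ⟨c * g₁.content, mul_ne_zero (nonZeroDivisors.ne_zero hc) ?_, ?_⟩
    · rwa [Ne, Polynomial.content_eq_zero_iff]
    · rw [Polynomial.C_mul, mul_assoc, ← g₁.eq_C_content_mul_primPart]
      exact hcg
  set J : Ideal S[X] := Submodule.comap (LinearMap.mulLeft S[X] g) I with hJ
  have hJmem : ∀ r, r ∈ J ↔ g * r ∈ I := fun r => Iff.rfl
  have hJrad : ∀ r : S[X], r * r ∈ J → r ∈ J := fun r hr => by
    rw [hJmem] at hr ⊢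
    refine hI ⟨2, ?_⟩
    have : (g * r) ^ 2 = g * (g * (r * r)) := by ring
    rw [this]
    exact I.mul_mem_left _ hr
  obtain ⟨p, hp⟩ := (IsPrincipalIdealRing.principal (J.comap Polynomial.C)).principal
  rw [← Ideal.span] at hp
  have hpmem : ∀ r, Polynomial.C r ∈ J ↔ p ∣ r := fun r => by
    rw [← Ideal.mem_span_singleton, ← hp]
    rfl
  have hp0 : p ≠ 0 := by
    rintro rfl
    refine hd (zero_dvd_iff.1 ((hpmem d).1 ?_))
    rwa [hJmem, mul_comm]
  have hpsq : Squarefree p := by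
    rintro x ⟨y, hxy⟩
    have h0 : x * y ≠ 0 := fun h => hp0 (by rw [hxy, mul_assoc, h, mul_zero])
    have h1 : p ∣ x * y := by
      rw [← hpmem]
      refine hJrad _ ?_
      rw [← Polynomial.C_mul, hpmem, hxy]
      exact ⟨y, by ring⟩
    rw [hxy, mul_assoc] at h1
    obtain ⟨z, hz⟩ := h1
    refine IsUnit.of_mul_eq_one z (mul_left_cancel₀ h0 ?_)
    linear_combination -hz
  obtain ⟨q, hq⟩ := Polynomial.exists_eq_span_pair_of_squarefree p hpsq hp0 J
    ((hpmem p).2 dvd_rfl)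
  refine ⟨g * Polynomial.C p, g * q, le_antisymm (fun x hx => ?_) (Ideal.span_le.2 ?_)⟩
  · obtain ⟨r, rfl⟩ := hgdvd x hx
    rw [← hJmem, hq, Ideal.mem_span_pair] at hx
    obtain ⟨s, t, rfl⟩ := hx
    rw [Ideal.mem_span_pair]
    exact ⟨s, t, by ring⟩
  · rintro x (rfl | rfl)
    · exact (hpmem p).2 dvd_rfl
    · rw [SetLike.mem_coe, ← hJmem, hq]
      exact Ideal.subset_span (Set.mem_insert_of_mem _ rfl)

theorem IsLocalization.exists_pair_of_map_eq_span {R L : Type*} [CommRing R] [IsNoetherianRing R]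
    [CommRing L] [Algebra R L] (M : Submonoid R) [IsLocalization M L] (I : Ideal R) {a' b' : L}
    (h : I.map (algebraMap R L) = Ideal.span {a', b'}) :
    ∃ a ∈ I, ∃ b ∈ I, ∃ m ∈ M, ∀ x ∈ I, m * x ∈ Ideal.span {a, b} := by
  have hnum : ∀ c ∈ I.map (algebraMap R L), ∃ a ∈ I,
      c ∈ (Ideal.span {a}).map (algebraMap R L) := fun c hc => by
    obtain ⟨⟨⟨a, ha⟩, m⟩, hm⟩ := (IsLocalization.mem_map_algebraMap_iff M L).1 hc
    exact ⟨a, ha, (IsLocalization.mem_map_algebraMap_iff M L).2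
      ⟨⟨⟨a, Ideal.mem_span_singleton_self a⟩, m⟩, hm⟩⟩
  obtain ⟨a, ha, haa⟩ := hnum a' (h ▸ Ideal.subset_span (Set.mem_insert _ _))
  obtain ⟨b, hb, hbb⟩ := hnum b' (h ▸ Ideal.subset_span (Set.mem_insert_of_mem _ rfl))
  have hle : I.map (algebraMap R L) ≤ (Ideal.span {a, b}).map (algebraMap R L) := by
    rw [h, Ideal.span_le]
    rintro x (rfl | rfl)
    · exact Ideal.map_mono (Ideal.span_mono (by simp)) haa
    · exact Ideal.map_mono (Ideal.span_mono (by simp)) hbb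
  have key : ∀ J : Ideal R, J ≤ I → J.FG → ∃ m ∈ M, ∀ x ∈ J, m * x ∈ Ideal.span {a, b} := by
    intro J hJI hJ
    induction J, hJ using Submodule.fg_induction with
    | singleton x =>
      obtain ⟨m, hm, hmx⟩ := (IsLocalization.algebraMap_mem_map_algebraMap_iff M L _ x).1
        (hle (Ideal.mem_map_of_mem _ (hJI (Submodule.mem_span_singleton_self x))))
      refine ⟨m, hm, fun y hy => ?_⟩
      obtain ⟨r, rfl⟩ := Submodule.mem_span_singleton.1 hy
      rw [smul_eq_mul, mul_left_comm]
      exact Ideal.mul_mem_left _ _ hmx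
    | sup J₁ J₂ _ _ h₁ h₂ =>
      obtain ⟨m₁, hm₁, h₁⟩ := h₁ (le_sup_left.trans hJI)
      obtain ⟨m₂, hm₂, h₂⟩ := h₂ (le_sup_right.trans hJI)
      refine ⟨m₁ * m₂, mul_mem hm₁ hm₂, fun x hx => ?_⟩
      obtain ⟨y, hy, z, hz, rfl⟩ := Submodule.mem_sup.1 hx
      have e : m₁ * m₂ * (y + z) = m₂ * (m₁ * y) + m₁ * (m₂ * z) := by ring
      rw [e]
      exact add_mem (Ideal.mul_mem_left _ _ (h₁ y hy)) (Ideal.mul_mem_left _ _ (h₂ z hz))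
  obtain ⟨m, hm, hmI⟩ := key I le_rfl (IsNoetherian.noetherian I)
  exact ⟨a, ha, b, hb, m, hm, hmI⟩

theorem Ideal.IsRadical.exists_smul_le_span_pair {D : Type*} [CommRing D] [IsDomain D]
    [IsNoetherianRing D] (K : Type*) [Field K] [Algebra D K]
    [IsFractionRing D K] (I : Ideal D[X][X]) (hI : I.IsRadical) :
    ∃ a ∈ I, ∃ b ∈ I, ∃ d : D, d ≠ 0 ∧
      ∀ x ∈ I, Polynomial.C (Polynomial.C d) * x ∈ Ideal.span {a, b} := by
  obtain ⟨M, hM, hMC⟩ : ∃ M : Submonoid D[X][X],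
      IsLocalization M K[X][X] ∧
        ∀ m ∈ M, ∃ d : D, d ≠ 0 ∧ Polynomial.C (Polynomial.C d) = m := by
    refine ⟨((nonZeroDivisors D).map Polynomial.C).map Polynomial.C,
      Polynomial.isLocalization _ _, ?_⟩
    rintro _ ⟨_, ⟨d, hd, rfl⟩, rfl⟩
    exact ⟨d, nonZeroDivisors.ne_zero hd, rfl⟩
  have hrad : (I.map (algebraMap D[X][X] K[X][X])).IsRadical := by
    rw [← Ideal.radical_eq_iff, ← IsLocalization.map_radical M, hI.radical]
  obtain ⟨a', b', hab⟩ := hrad.exists_eq_span_pair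
  obtain ⟨a, ha, b, hb, m, hm, h⟩ := IsLocalization.exists_pair_of_map_eq_span M I hab
  obtain ⟨d, hd, rfl⟩ := hMC m hm
  exact ⟨a, ha, b, hb, d, hd, h⟩

end TwoGenerators

/-! ### Torsion-free radical ideals -/

section TorsionFree

theorem mem_linearSpan_of_mem_linearSpan_smul {R ι : Type*} [CommRing R] [IsDomain R] [Fintype ι]
    {c : R} (hc : c ≠ 0) {f : ι → R} {M : Matrix ι ι R} (hM : M ∈ linearSpan (c • f)) :
    M ∈ linearSpan f := by
  obtain ⟨N, hN, hA⟩ := hM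
  rw [Matrix.smul_vecMul] at hN
  exact ⟨N, (smul_eq_zero.1 hN).resolve_left hc, hA⟩

theorem mem_linearSpan_of_C_C_smul_mem {D ι : Type*} [CommRing D] [IsDomain D]
    [IsPrincipalIdealRing D] [Fintype ι] {f : ι → D[X][X]}
    (hI : ∀ (d : D) (r : D[X][X]), d ≠ 0 →
      Polynomial.C (Polynomial.C d) * r ∈ Ideal.span (Set.range f) →
        r ∈ Ideal.span (Set.range f))
    (d : D) (hd : d ≠ 0) {U : Matrix ι ι D[X][X]}
    (hU : Polynomial.C (Polynomial.C d) • U ∈ linearSpan f) : U ∈ linearSpan f := by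
  induction d using WfDvdMonoid.induction_on_irreducible generalizing U with
  | zero => exact absurd rfl hd
  | unit u hu =>
    obtain ⟨u, rfl⟩ := hu
    have := (linearSpan f).smul_mem (Polynomial.C (Polynomial.C ((u⁻¹ : Dˣ) : D))) hU
    rwa [smul_smul, ← Polynomial.C_mul, ← Polynomial.C_mul, Units.inv_mul, Polynomial.C_1,
      Polynomial.C_1, one_smul] at this
  | mul a i ha hi ih =>
    rw [Polynomial.C_mul, Polynomial.C_mul, mul_smul] at hU
    refine ih ha ?_
    have : (Ideal.span {i}).IsMaximal := PrincipalIdealRing.isMaximal_of_irreducible hi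
    let _ := Ideal.Quotient.field (Ideal.span {i})
    set π : D[X][X] →+* (D ⧸ Ideal.span {i})[X][X] :=
      Polynomial.mapRingHom (Polynomial.mapRingHom (Ideal.Quotient.mk _)) with hπ
    refine mem_linearSpan_of_smul_mem (R := D[X][X]) (R' := (D ⧸ Ideal.span {i})[X][X]) π ?_
      (a := Polynomial.C (Polynomial.C i)) ?_ ?_ ?_
      (fun r => hI i r hi.ne_zero) hU
    · exact Polynomial.map_surjective _
        (Polynomial.map_surjective _ Ideal.Quotient.mk_surjective)
    · exact mem_nonZeroDivisors_of_ne_zero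
        (Polynomial.C_ne_zero.2 (Polynomial.C_ne_zero.2 hi.ne_zero))
    · rw [hπ, Polynomial.ker_mapRingHom, Polynomial.ker_mapRingHom, Ideal.mk_ker, Ideal.map_span,
        Set.image_singleton, Ideal.map_span, Set.image_singleton]
    · have := Polynomial.projective_ker_of_field
        (Fintype.linearCombination (D ⧸ Ideal.span {i})[X][X] (π ∘ f))
      exact hasAlternatingSyzygies _

theorem Ideal.IsRadical.quadraticIsLinear_of_torsionFree {D : Type*} [CommRing D] [IsDomain D]
    [IsPrincipalIdealRing D] (I : Ideal D[X][X]) (hI : I.IsRadical)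
    (hI' : ∀ (d : D) (r : D[X][X]), d ≠ 0 → Polynomial.C (Polynomial.C d) * r ∈ I → r ∈ I) :
    Ideal.QuadraticIsLinear (R := D[X][X]) I := by
  rintro s f rfl M hM
  obtain ⟨a, ha, b, hb, d, hd, h⟩ := hI.exists_smul_le_span_pair (FractionRing D)
  have hr : Ideal.span (Set.range ![a, b]) = Ideal.span {a, b} := by
    rw [Matrix.range_cons, Matrix.range_cons, Matrix.range_empty, Set.union_empty]; rfl
  refine mem_linearSpan_of_C_C_smul_mem hI' (d * d) (mul_ne_zero hd hd) ?_
  set c := Polynomial.C (Polynomial.C d) with hc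
  have hc0 : c ≠ 0 := Polynomial.C_ne_zero.2 (Polynomial.C_ne_zero.2 hd)
  rw [Polynomial.C_mul, Polynomial.C_mul]
  refine mem_linearSpan_of_mem_linearSpan_smul hc0 (smul_mem_linearSpan (f' := ![a, b]) ?_ ?_
    (quadraticIsLinear_pair a b) ?_)
  · rw [hr, Ideal.span_le]
    rintro _ ⟨i, rfl⟩
    exact h _ (Ideal.subset_span ⟨i, rfl⟩)
  · intro x hx
    obtain ⟨v, rfl⟩ := Ideal.mem_span_range_iff_exists_fun.1
      ((Ideal.span_le.2 (by rintro y (rfl | rfl) <;> assumption) :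
        Ideal.span {a, b} ≤ Ideal.span (Set.range f)) (hr ▸ hx))
    refine Ideal.mem_span_range_iff_exists_fun.2 ⟨v, ?_⟩
    rw [Finset.mul_sum]
    exact Finset.sum_congr rfl fun i _ => by
      rw [Pi.smul_apply, smul_eq_mul, mul_left_comm]
  · rw [Matrix.mulVec_smul, dotProduct_smul, smul_dotProduct, hM, smul_zero, smul_zero]

end TorsionFree

/-! ### Local analysis of a radical ideal -/

section Assembly

theorem Ideal.quadraticIsLinear_of_forall_isMaximal {R : Type*} [CommRing R] [IsNoetherianRing R]
    (I : Ideal R) (h : ∀ m : Ideal R, m.IsMaximal → ∃ r ∉ m, ∃ J : Ideal R, I ≤ J ∧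
      (∀ x ∈ J, r * x ∈ I) ∧ J.QuadraticIsLinear) : I.QuadraticIsLinear := by
  rintro s f rfl M hM
  by_contra hMf
  obtain ⟨m, hm, hle⟩ := Ideal.exists_le_maximal (linearSpanColon f M) fun htop => hMf (by
    have : (1 : R) ∈ linearSpanColon f M := htop ▸ Submodule.mem_top
    rwa [mem_linearSpanColon, one_smul] at this)
  obtain ⟨r, hr, J, hIJ, hrJ, hJ⟩ := h m hm
  obtain ⟨t, f', rfl⟩ := Submodule.fg_iff_exists_fin_generating_family.1
    (IsNoetherian.noetherian J)
  have := hle (mem_linearSpanColon.2 (smul_mem_linearSpan hIJ hrJ (hJ t f' rfl) hM))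
  exact hr ((hm.isPrime.mem_or_mem this).elim id id)

theorem Ideal.IsRadical.exists_notMem_forall_mul_mem {R : Type*} [CommRing R] [IsNoetherianRing R]
    {I : Ideal R} (hI : I.IsRadical) (m : Ideal R) [m.IsPrime] (S : Set (Ideal R))
    (hS : ∀ P ∈ I.minimalPrimes, P ∈ S → ¬ P ≤ m) :
    ∃ r ∉ m, ∀ x, (∀ P ∈ I.minimalPrimes, P ∉ S → x ∈ P) → r * x ∈ I := by
  classical
  have hfin := I.finite_minimalPrimes_of_isNoetherianRing
  set T := hfin.toFinset.filter (· ∈ S) with hT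
  have hTm : ¬ T.inf id ≤ m := fun h => by
    obtain ⟨P, hP, hPm⟩ := (Ideal.IsPrime.inf_le' ‹_›).1 h
    rw [hT, Finset.mem_filter, Set.Finite.mem_toFinset] at hP
    exact hS P hP.1 hP.2 hPm
  obtain ⟨r, hr, hrm⟩ := Set.not_subset.1 hTm
  refine ⟨r, hrm, fun x hx => ?_⟩
  rw [← hI.radical, ← Ideal.sInf_minimalPrimes, Ideal.mem_sInf]
  intro P hP
  by_cases hPS : P ∈ S
  · have : T.inf id ≤ P := Finset.inf_le (f := id) (by simp [hT, hP, hPS])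
    exact P.mul_mem_right _ (this hr)
  · exact P.mul_mem_left _ (hx P hP hPS)

theorem Ideal.IsRadical.quadraticIsLinear_of_minimalPrimes {k : Type*} [Field k]
    (I : Ideal k[X][X][X]) (hI : Ideal.IsRadical (R := k[X][X][X]) I)
    (hP : ∀ P ∈ Ideal.minimalPrimes (R := k[X][X][X]) I, P.IsMaximal ∨
      ∀ d : k[X], Polynomial.C (Polynomial.C d) ∈ P → d = 0) :
    Ideal.QuadraticIsLinear (R := k[X][X][X]) I := by
  refine Ideal.quadraticIsLinear_of_forall_isMaximal (R := k[X][X][X]) I fun m hm => ?_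
  have hmp := hm.isPrime
  by_cases hmin : m ∈ Ideal.minimalPrimes (R := k[X][X][X]) I
  · obtain ⟨r, hr, h⟩ := hI.exists_notMem_forall_mul_mem m {P | P ≠ m}
      fun P hP hPm hle => hPm (le_antisymm hle (hmin.2 hP.1 hle))
    refine ⟨r, hr, m, hmin.1.2, fun x hx => h x fun P _ hPm => ?_, hm.quadraticIsLinear⟩
    rwa [not_not.1 hPm]
  · obtain ⟨r, hr, h⟩ := hI.exists_notMem_forall_mul_mem m {P | P.IsMaximal}
      fun P hP hPmax hle => hmin (hPmax.eq_of_le hm.ne_top hle ▸ hP)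
    refine ⟨r, hr, sInf {P | P ∈ I.minimalPrimes ∧ ¬ P.IsMaximal}, ?_, ?_, ?_⟩
    · exact le_sInf fun P hP => hP.1.1.2
    · exact fun x hx => h x fun P hP hPm => Ideal.mem_sInf.1 hx ⟨hP, hPm⟩
    · refine Ideal.IsRadical.quadraticIsLinear_of_torsionFree (D := k[X]) _ ?_ ?_
      · rintro x ⟨n, hx⟩
        rw [Ideal.mem_sInf] at hx ⊢
        exact fun P hP => hP.1.1.1.mem_of_pow_mem n (hx hP)
      · intro d x hd hx
        rw [Ideal.mem_sInf] at hx ⊢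
        intro P hPP
        exact (hPP.1.1.1.mem_or_mem (hx hPP)).resolve_left fun hdP =>
          hd (((hP P hPP.1).resolve_left hPP.2) d hdP)

end Assembly

/-! ### Choice of coordinates -/

section Coordinates

theorem QuadraticIsLinear.of_ringEquiv {R R' ι : Type*} [CommRing R] [CommRing R'] [Fintype ι]
    (e : R ≃+* R') {f : ι → R} (hf : QuadraticIsLinear (e ∘ f)) : QuadraticIsLinear f := by
  intro M hM
  obtain ⟨N, hN, hA⟩ := hf (M.map e) (by
    rw [← map_zero e, ← hM]
    simp [dotProduct, Matrix.mulVec, map_sum])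
  refine ⟨N.map e.symm, ?_, fun i => ?_, ?_⟩
  · ext j
    have := congrArg e.symm (congrFun hN j)
    simpa [Matrix.vecMul, dotProduct, map_sum] using this
  · have := congrArg e.symm (hA.1 i)
    simpa using this
  · ext i j
    have := congrArg e.symm (hA.apply_swap j i)
    simpa using this

theorem Ideal.QuadraticIsLinear.of_ringEquiv {R R' : Type*} [CommRing R] [CommRing R']
    (e : R ≃+* R') {I : Ideal R} (h : (I.comap e.symm).QuadraticIsLinear) :
    I.QuadraticIsLinear := by
  rintro s f rfl
  refine _root_.QuadraticIsLinear.of_ringEquiv e (h s _ ?_)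
  rw [Ideal.comap_symm, Ideal.map_span, Set.range_comp]

theorem IsAlgebraic.of_add_pow {k B : Type*} [Field k] [CommRing B] [Algebra k B]
    {a b : B} {m n : ℕ} (hmn : m < n) (hm : IsAlgebraic k (a + b ^ m))
    (hn : IsAlgebraic k (a + b ^ n)) : IsAlgebraic k a ∧ IsAlgebraic k b := by
  have hdeg : (Polynomial.X ^ n - Polynomial.X ^ m : k[X]).natDegree = n := by
    rw [Polynomial.natDegree_sub_eq_left_of_natDegree_lt] <;> simp [hmn]
  have hb : IsAlgebraic k b := by
    refine IsAlgebraic.of_aeval (Polynomial.X ^ n - Polynomial.X ^ m) ?_ ?_ ?_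
    · omega
    · refine mem_nonZeroDivisors_of_ne_zero (Polynomial.leadingCoeff_ne_zero.2 fun h => ?_)
      rw [h, Polynomial.natDegree_zero] at hdeg
      omega
    · have := hn.sub hm
      simpa using this
  refine ⟨?_, hb⟩
  have := hm.sub (hb.pow m)
  rwa [add_sub_cancel_right] at this

theorem exists_transcendental_add_pow {k A : Type*} [Field k] [CommRing A] [Algebra k A] (a b : A)
    {T : Set (Ideal A)} (hT : T.Finite) :
    ∃ n : ℕ, ∀ P ∈ T, (Transcendental k (Ideal.Quotient.mk P a) ∨
      Transcendental k (Ideal.Quotient.mk P b)) →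
        Transcendental k (Ideal.Quotient.mk P (a + b ^ n)) := by
  have hfin : (⋃ P ∈ T, {n : ℕ | (Transcendental k (Ideal.Quotient.mk P a) ∨
      Transcendental k (Ideal.Quotient.mk P b)) ∧
        ¬ Transcendental k (Ideal.Quotient.mk P (a + b ^ n))}).Finite := by
    refine hT.biUnion fun P _ => Set.Subsingleton.finite fun m hm n hn => ?_
    by_contra hne
    wlog hlt : m < n generalizing m n
    · exact this n hn m hm (Ne.symm hne) (by omega)
    simp only [Set.mem_ofPred_eq, Transcendental, not_not, map_add, map_pow] at hm hn
    have := IsAlgebraic.of_add_pow hlt hm.2 hn.2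
    exact hm.1.elim (fun h => h this.1) fun h => h this.2
  obtain ⟨n, hn⟩ := hfin.exists_notMem
  refine ⟨n, fun P hP h => ?_⟩
  by_contra hcon
  exact hn (Set.mem_biUnion hP ⟨h, hcon⟩)

theorem MvPolynomial.isMaximal_of_forall_isAlgebraic {k σ : Type*} [Field k]
    (P : Ideal (MvPolynomial σ k)) [P.IsPrime]
    (h : ∀ i, IsAlgebraic k (Ideal.Quotient.mk P (MvPolynomial.X i))) : P.IsMaximal := by
  have htop : Algebra.adjoin k (Set.range fun i => Ideal.Quotient.mk P (MvPolynomial.X i)) = ⊤ := by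
    have := congrArg (Subalgebra.map (Ideal.Quotient.mkₐ k P))
      (MvPolynomial.adjoin_range_X (R := k) (σ := σ))
    rw [AlgHom.map_adjoin, ← Set.range_comp, Algebra.map_top,
      (AlgHom.range_eq_top _).2 (Ideal.Quotient.mkₐ_surjective k P)] at this
    exact this
  have h_int : Algebra.IsIntegral k (MvPolynomial σ k ⧸ P) := by
    constructor
    intro x
    have hx : x ∈ Algebra.adjoin k (Set.range fun i => Ideal.Quotient.mk P (MvPolynomial.X i)) :=
      htop ▸ Algebra.mem_top
    refine Algebra.adjoin_le (S := integralClosure k _) ?_ hx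
    rintro _ ⟨i, rfl⟩
    exact (h i).isIntegral
  exact Ideal.Quotient.maximal_of_isField P (isField_of_isIntegral_of_isField' (Field.toIsField k))

/-- Writing polynomials in `x₀, x₁, x₂` as polynomials in `x₀ + x₁ⁿ + x₂ᵐ`, `x₁`, `x₂`. -/
noncomputable def toIteratedPolynomial (k : Type*) [Field k] (n m : ℕ) :
    MvPolynomial (Fin 3) k →ₐ[k] k[X][X][X] :=
  MvPolynomial.aeval (S₁ := k[X][X][X])
    ![Polynomial.C (R := k[X][X]) (Polynomial.C (R := k[X]) Polynomial.X) -
      Polynomial.C (R := k[X][X]) Polynomial.X ^ n - Polynomial.X ^ m,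
      Polynomial.C (R := k[X][X]) Polynomial.X, Polynomial.X]

/-- Substituting `x₀ + x₁ⁿ + x₂ᵐ`, `x₁`, `x₂` for the variables of an iterated polynomial ring. -/
noncomputable def ofIteratedPolynomial (k : Type*) [Field k] (n m : ℕ) :
    k[X][X][X] →+* MvPolynomial (Fin 3) k :=
  Polynomial.eval₂RingHom (Polynomial.eval₂RingHom
    (Polynomial.aeval (R := k)
      (MvPolynomial.X 0 + MvPolynomial.X 1 ^ n + MvPolynomial.X 2 ^ m)).toRingHom
    (MvPolynomial.X 1)) (MvPolynomial.X 2)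

theorem ofIteratedPolynomial_C_C {k : Type*} [Field k] (n m : ℕ) (d : k[X]) :
    ofIteratedPolynomial k n m (Polynomial.C (Polynomial.C d)) =
      Polynomial.aeval (MvPolynomial.X 0 + MvPolynomial.X 1 ^ n + MvPolynomial.X 2 ^ m) d := by
  simp [ofIteratedPolynomial]

theorem map_sub_pow_sub_pow {A B : Type*} [CommRing A] [CommRing B] (φ : A →+* B) (a b c : A)
    (n m : ℕ) : φ (a - b ^ n - c ^ m) = φ a - φ b ^ n - φ c ^ m := by
  simp

theorem ofIteratedPolynomial_toIteratedPolynomial {k : Type*} [Field k] (n m : ℕ)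
    (p : MvPolynomial (Fin 3) k) :
    ofIteratedPolynomial k n m (toIteratedPolynomial k n m p) = p := by
  have h : ((ofIteratedPolynomial k n m).comp
      (toIteratedPolynomial k n m : MvPolynomial (Fin 3) k →+* k[X][X][X])) =
      RingHom.id (MvPolynomial (Fin 3) k) := by
    refine MvPolynomial.ringHom_ext (fun r => ?_) fun i => ?_
    · simp [toIteratedPolynomial, ofIteratedPolynomial, Polynomial.algebraMap_apply,
        MvPolynomial.algebraMap_eq]
    · have h1 : ofIteratedPolynomial k n m (Polynomial.C Polynomial.X) = MvPolynomial.X 1 := by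
        simp [ofIteratedPolynomial]
      have h2 : ofIteratedPolynomial k n m Polynomial.X = MvPolynomial.X 2 := by
        simp [ofIteratedPolynomial]
      have h0 := ofIteratedPolynomial_C_C (k := k) n m Polynomial.X
      rw [Polynomial.aeval_X] at h0
      rw [RingHom.comp_apply, RingHom.coe_coe, toIteratedPolynomial, MvPolynomial.aeval_X]
      fin_cases i
      · refine (map_sub_pow_sub_pow (A := k[X][X][X]) (ofIteratedPolynomial k n m) _ _ _ n m).trans ?_
        rw [h0, h1, h2, RingHom.id_apply]
        change _ = MvPolynomial.X 0
        ring
      · exact h1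
      · exact h2
  exact RingHom.congr_fun h p

theorem toIteratedPolynomial_ofIteratedPolynomial {k : Type*} [Field k] (n m : ℕ)
    (p : k[X][X][X]) :
    toIteratedPolynomial k n m (ofIteratedPolynomial k n m p) = p := by
  have h : ((toIteratedPolynomial k n m : MvPolynomial (Fin 3) k →+* k[X][X][X]).comp
      (ofIteratedPolynomial k n m)) = RingHom.id k[X][X][X] := by
    refine Polynomial.ringHom_ext' (Polynomial.ringHom_ext' (Polynomial.ringHom_ext'
      (RingHom.ext fun r => ?_) ?_) ?_) ?_
    · simp [toIteratedPolynomial, ofIteratedPolynomial, Polynomial.algebraMap_apply]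
    · simp only [toIteratedPolynomial, ofIteratedPolynomial]
      simp
      ring
    · simp [toIteratedPolynomial, ofIteratedPolynomial]
    · simp [toIteratedPolynomial, ofIteratedPolynomial]
  exact RingHom.congr_fun h p

theorem exists_ringEquiv_iteratedPolynomial (k : Type*) [Field k] (n m : ℕ) :
    ∃ e : MvPolynomial (Fin 3) k ≃+* k[X][X][X], ∀ d : k[X],
      e.symm (Polynomial.C (Polynomial.C d)) =
        Polynomial.aeval (MvPolynomial.X 0 + MvPolynomial.X 1 ^ n + MvPolynomial.X 2 ^ m) d :=
  ⟨{ (toIteratedPolynomial k n m : MvPolynomial (Fin 3) k →+* k[X][X][X]) with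
      invFun := ofIteratedPolynomial k n m
      left_inv := ofIteratedPolynomial_toIteratedPolynomial n m
      right_inv := toIteratedPolynomial_ofIteratedPolynomial n m },
    ofIteratedPolynomial_C_C n m⟩

theorem exists_forall_transcendental {k : Type*} [Field k] (I : Ideal (MvPolynomial (Fin 3) k)) :
    ∃ n m : ℕ, ∀ P ∈ I.minimalPrimes, P.IsMaximal ∨ Transcendental k (Ideal.Quotient.mk P
      (MvPolynomial.X 0 + MvPolynomial.X 1 ^ n + MvPolynomial.X 2 ^ m)) := by
  have hfin := I.finite_minimalPrimes_of_isNoetherianRing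
  obtain ⟨n, hn⟩ := exists_transcendental_add_pow (k := k) (MvPolynomial.X 0) (MvPolynomial.X 1)
    hfin
  obtain ⟨m, hm⟩ := exists_transcendental_add_pow (k := k)
    (MvPolynomial.X 0 + MvPolynomial.X 1 ^ n) (MvPolynomial.X 2) hfin
  refine ⟨n, m, fun P hP => or_iff_not_imp_left.2 fun hPm => hm P hP ?_⟩
  have hPp := hP.1.1
  obtain ⟨i, hi⟩ : ∃ i, Transcendental k (Ideal.Quotient.mk P (MvPolynomial.X i)) := by
    by_contra! hcon
    exact hPm (MvPolynomial.isMaximal_of_forall_isAlgebraic P fun i => not_not.1 (hcon i))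
  fin_cases i
  · exact .inl (hn P hP (.inl hi))
  · exact .inl (hn P hP (.inr hi))
  · exact .inr hi

theorem Ideal.IsRadical.quadraticIsLinear_of_ringEquiv {k A B : Type*} [Field k] [CommRing A]
    [Algebra k A] [CommRing B] (c : k[X] → B)
    (H : ∀ J : Ideal B, J.IsRadical →
      (∀ P ∈ J.minimalPrimes, P.IsMaximal ∨ ∀ d : k[X], c d ∈ P → d = 0) → J.QuadraticIsLinear)
    (e : A ≃+* B) (w : A) (hc : ∀ d, e.symm (c d) = Polynomial.aeval w d) {I : Ideal A}
    (hI : I.IsRadical)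
    (hw : ∀ P ∈ I.minimalPrimes, P.IsMaximal ∨ Transcendental k (Ideal.Quotient.mk P w)) :
    I.QuadraticIsLinear := by
  refine Ideal.QuadraticIsLinear.of_ringEquiv e (H _ (hI.comap e.symm) fun P' hP' => ?_)
  rw [← Ideal.comap_coe, Ideal.comap_minimalPrimes_eq_of_surjective e.symm.surjective] at hP'
  obtain ⟨P, hP, rfl⟩ := hP'
  refine (hw P hP).imp (fun hPm : P.IsMaximal => Ideal.comap_isMaximal_of_surjective
    (e.symm : B →+* A) e.symm.surjective) fun hw d hd => transcendental_iff.1 hw d ?_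
  have h1 : e.symm (c d) ∈ P := hd
  rw [hc, ← Ideal.Quotient.eq_zero_iff_mem] at h1
  rw [← h1]
  exact Polynomial.aeval_algHom_apply (Ideal.Quotient.mkₐ k P) _ d

theorem Ideal.IsRadical.quadraticIsLinear {k : Type*} [Field k]
    {I : Ideal (MvPolynomial (Fin 3) k)} (hI : I.IsRadical) : I.QuadraticIsLinear := by
  obtain ⟨n, m, hnm⟩ := exists_forall_transcendental I
  obtain ⟨e, he⟩ := exists_ringEquiv_iteratedPolynomial k n m
  exact Ideal.IsRadical.quadraticIsLinear_of_ringEquiv (B := k[X][X][X]) _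
    Ideal.IsRadical.quadraticIsLinear_of_minimalPrimes e _ he hI hnm

end Coordinates

/-! ### Equations of the Rees algebra -/

section ReesEquations

open Matrix

variable {R : Type*} [CommRing R]

/-- The quadratic form with matrix `M`. -/
noncomputable def quadraticPolynomial {s : ℕ} (M : Matrix (Fin s) (Fin s) R) :
    MvPolynomial (Fin s) R :=
  MvPolynomial.X ⬝ᵥ M.map MvPolynomial.C *ᵥ MvPolynomial.X

theorem quadraticPolynomial_add {s : ℕ} (M N : Matrix (Fin s) (Fin s) R) :
    quadraticPolynomial (M + N) = quadraticPolynomial M + quadraticPolynomial N := by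
  rw [quadraticPolynomial, Matrix.map_add _ fun _ _ => MvPolynomial.C_add, add_mulVec, dotProduct_add]
  rfl

theorem IsAlternating.quadraticPolynomial_eq_zero {s : ℕ} {A : Matrix (Fin s) (Fin s) R}
    (hA : IsAlternating A) : quadraticPolynomial A = 0 := by
  refine IsAlternating.dotProduct_mulVec_self ⟨fun i => by simp [hA.1], ?_⟩ _
  rw [← transpose_map, hA.2]
  ext1 i j
  simp

theorem exists_eq_quadraticPolynomial {s : ℕ} {u : MvPolynomial (Fin s) R}
    (hu : u.IsHomogeneous 2) : ∃ M, u = quadraticPolynomial M := by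
  classical
  rw [← u.support_sum_monomial_coeff]
  refine Finset.sum_induction _ (fun v => ∃ M, v = quadraticPolynomial M) ?_ ?_ fun d hd => ?_
  · rintro _ _ ⟨M, rfl⟩ ⟨N, rfl⟩
    exact ⟨M + N, (quadraticPolynomial_add M N).symm⟩
  · exact ⟨0, by simp [quadraticPolynomial]⟩
  · have hdeg : d.degree = 2 := by
      by_contra h
      exact MvPolynomial.mem_support_iff.1 hd (hu.coeff_eq_zero h)
    obtain ⟨i, j, hij⟩ := Multiset.card_eq_two.1
      ((Finsupp.card_toMultiset d).trans hdeg)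
    have hd : d = Finsupp.single i 1 + Finsupp.single j 1 := by
      rw [← Finsupp.toMultiset_toFinsupp d, hij, Multiset.insert_eq_cons, ← Multiset.singleton_add,
        map_add, Multiset.toFinsupp_singleton, Multiset.toFinsupp_singleton]
    refine ⟨Matrix.single i j (u.coeff d), ?_⟩
    generalize u.coeff d = r
    have : (Matrix.single i j r).map (MvPolynomial.C : R →+* MvPolynomial (Fin s) R) =
        Matrix.single i j (MvPolynomial.C r) := by
      rw [Matrix.map_single]
    rw [quadraticPolynomial, this, hd]
    simp [Matrix.single_mulVec, MvPolynomial.X, MvPolynomial.C_mul_monomial, dotProduct,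
      Function.update_apply]

theorem quadraticPolynomial_mem_reesKer {s : ℕ} {f : Fin s → R} {M : Matrix (Fin s) (Fin s) R} :
    quadraticPolynomial M ∈ reesKer f ↔ f ⬝ᵥ M *ᵥ f = 0 := by
  have h : MvPolynomial.aeval (fun i => Polynomial.C (f i) * Polynomial.X) (quadraticPolynomial M) =
      Polynomial.C (f ⬝ᵥ M *ᵥ f) * Polynomial.X ^ 2 := by
    simp only [quadraticPolynomial, dotProduct, mulVec, map_sum, map_mul, Matrix.map_apply,
      MvPolynomial.aeval_X, MvPolynomial.algHom_C, Polynomial.algebraMap_eq, Finset.sum_mul,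
      Finset.mul_sum]
    exact Finset.sum_congr rfl fun i _ => Finset.sum_congr rfl fun j _ => by ring
  rw [reesKer, RingHom.mem_ker, h, Polynomial.C_mul_X_pow_eq_monomial,
    Polynomial.monomial_eq_zero_iff]

theorem quadraticPolynomial_mem_span_linear {s : ℕ} {f : Fin s → R}
    {N : Matrix (Fin s) (Fin s) R} (hN : f ᵥ* N = 0) :
    quadraticPolynomial N ∈ Ideal.span {p | p ∈ reesKer f ∧ ∃ q ≤ 1, p.IsHomogeneous q} := by
  rw [quadraticPolynomial, dotProduct_mulVec]
  refine Ideal.sum_mem _ fun j _ => Ideal.mul_mem_right _ _ (Ideal.subset_span ⟨?_, 1, le_rfl, ?_⟩)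
  · rw [reesKer, RingHom.mem_ker]
    have := congrArg (fun r => Polynomial.C r * Polynomial.X) (congrFun hN j)
    simp only [vecMul, dotProduct, Pi.zero_apply, map_zero, zero_mul, map_sum, map_mul,
      Matrix.map_apply, MvPolynomial.aeval_X, MvPolynomial.algHom_C, Polynomial.algebraMap_eq,
      Finset.sum_mul] at this ⊢
    rw [← this]
    exact Finset.sum_congr rfl fun i _ => by ring
  · refine MvPolynomial.IsHomogeneous.sum _ _ _ fun i _ => ?_
    exact (MvPolynomial.isHomogeneous_X R i).mul (MvPolynomial.isHomogeneous_C _ _)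

theorem QuadraticIsLinear.mem_span_linear {s : ℕ} {f : Fin s → R} (hf : QuadraticIsLinear f)
    {u : MvPolynomial (Fin s) R} (hu : u ∈ reesKer f) (hu2 : u.IsHomogeneous 2) :
    u ∈ Ideal.span {p | p ∈ reesKer f ∧ ∃ q ≤ 1, p.IsHomogeneous q} := by
  obtain ⟨M, rfl⟩ := exists_eq_quadraticPolynomial hu2
  obtain ⟨N, hN, hA⟩ := hf M (quadraticPolynomial_mem_reesKer.1 hu)
  rw [← sub_add_cancel M N, quadraticPolynomial_add, hA.quadraticPolynomial_eq_zero, zero_add]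
  exact quadraticPolynomial_mem_span_linear hN

theorem GenInDegLE.one_of_two {s : ℕ} {f : Fin s → R} (hf : QuadraticIsLinear f)
    (h : GenInDegLE (reesKer f) 2) : GenInDegLE (reesKer f) 1 := by
  refine le_antisymm ?_ (Ideal.span_le.2 fun p hp => hp.1)
  nth_rewrite 1 [h]
  refine Ideal.span_le.2 ?_
  rintro p ⟨hp, q, hq, hpq⟩
  obtain hq | rfl := Nat.lt_or_eq_of_le hq
  · exact Ideal.subset_span ⟨hp, q, Nat.le_of_lt_succ hq, hpq⟩
  · exact hf.mem_span_linear hp hpq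

theorem Ideal.QuadraticIsLinear.relType_ne_two {I : Ideal R} (hI : I.QuadraticIsLinear) :
    relType I ≠ 2 := by
  intro h
  have hmem := Nat.sInf_mem (Nat.nonempty_of_pos_sInf (h ▸ two_pos : 0 < relType I))
  change relType I ∈ _ at hmem
  rw [h] at hmem
  have : relType I ≤ 1 :=
    Nat.sInf_le ⟨le_rfl, fun s f hf => (hmem.2 s f hf).one_of_two (hI s f hf)⟩
  omega

end ReesEquations

/-- **Corollary.** There is no proper radical ideal of `k[x,y,z]` of relation type `2`;
equivalently, there are no reduced affine `k`-algebras (and no affine algebraic `k`-varieties)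
of embedding dimension `3` and relation type `2`. -/
theorem no_relType_two_in_three_variables {k : Type*} [Field k]
    (I : Ideal (MvPolynomial (Fin 3) k)) (hI : I ≠ ⊤) (hrad : I.IsRadical) :
    relType I ≠ 2 :=
  hrad.quadraticIsLinear.relType_ne_two
end

section
/- Let R be a commutative ring, let g ∈ R, and let L = 𝔭_1 ∩ … ∩ 𝔭_r be an intersection of prime ideals of R such that g ∉ 𝔭_j for every j = 1,…,r. Then (g) ∩ L = gL. -/
/-- If `g ∉ 𝔭ⱼ` for each member of a finite family of primes `𝔭₁,…,𝔭_r` of a commutative ring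
`R`, and `L = 𝔭₁ ∩ … ∩ 𝔭_r`, then `(g) ∩ L = gL`. -/
theorem span_inter_eq_mul {R : Type*} [CommRing R] (g : R) {r : ℕ}
    (𝔭 : Fin r → Ideal R) (hprime : ∀ j, (𝔭 j).IsPrime) (hg : ∀ j, g ∉ 𝔭 j) :
    Ideal.span {g} ⊓ (⨅ j, 𝔭 j) = Ideal.span {g} * ⨅ j, 𝔭 j := by
  refine le_antisymm ?_ Ideal.mul_le_inf
  rintro x ⟨hx, hxL⟩
  obtain ⟨a, rfl⟩ := Ideal.mem_span_singleton.mp hx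
  refine Ideal.mul_mem_mul (Ideal.mem_span_singleton_self g) (Ideal.mem_iInf.mpr fun j => ?_)
  exact ((hprime j).mem_or_mem (Ideal.mem_iInf.mp hxL j)).resolve_left (hg j)
end

section
/- Let k be a field, R = k[x_1,…,x_n], let J be a proper ideal of R, and let 𝔪_1,…,𝔪_r be maximal ideals of R such that J ⊄ 𝔪_j for each j = 1,…,r. Then rt(J ∩ 𝔪_1 ∩ … ∩ 𝔪_r) = rt(J). -/
open Polynomial MvPolynomial

section RelationType

variable {R S σ τ : Type*} [CommRing R] [CommRing S]

/-- The ideal generated by the forms of degree at most `N` vanishing at `f`. -/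
noncomputable def eqsIdeal (f : σ → R) (N : ℕ) : Ideal (MvPolynomial σ R) :=
  Ideal.span {p | ∃ q ≤ N, p.IsHomogeneous q ∧ MvPolynomial.eval f p = 0}

/-- Every form vanishing at `f` is generated by such forms of degree at most `N`. -/
def EqsGenInDegLE (f : σ → R) (N : ℕ) : Prop :=
  ∀ (q : ℕ) (F : MvPolynomial σ R), F.IsHomogeneous q → MvPolynomial.eval f F = 0 →
    F ∈ eqsIdeal f N

theorem mem_eqsIdeal {f : σ → R} {N q : ℕ} {F : MvPolynomial σ R} (hq : q ≤ N)
    (hF : F.IsHomogeneous q) (h : MvPolynomial.eval f F = 0) : F ∈ eqsIdeal f N :=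
  Ideal.subset_span ⟨q, hq, hF, h⟩

theorem eqsIdeal_mono (f : σ → R) {M N : ℕ} (h : M ≤ N) : eqsIdeal f M ≤ eqsIdeal f N :=
  Ideal.span_mono fun _ ⟨q, hq, hp⟩ ↦ ⟨q, hq.trans h, hp⟩

theorem EqsGenInDegLE.mono {f : σ → R} {M N : ℕ} (hf : EqsGenInDegLE f M) (h : M ≤ N) :
    EqsGenInDegLE f N :=
  fun q F hF hF0 ↦ eqsIdeal_mono f h (hf q F hF hF0)

/-- A ring homomorphism carrying forms vanishing at `f` to forms of the same degree
vanishing at `g` carries `eqsIdeal f N` into `eqsIdeal g N`. -/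
theorem map_mem_eqsIdeal {f : σ → R} {g : τ → S} {N : ℕ}
    (φ : MvPolynomial σ R →+* MvPolynomial τ S)
    (hφ : ∀ q p, p.IsHomogeneous q → MvPolynomial.eval f p = 0 →
      (φ p).IsHomogeneous q ∧ MvPolynomial.eval g (φ p) = 0)
    {F : MvPolynomial σ R} (hF : F ∈ eqsIdeal f N) : φ F ∈ eqsIdeal g N := by
  have h : (eqsIdeal f N).map φ ≤ eqsIdeal g N := by
    rw [eqsIdeal, Ideal.map_span, Ideal.span_le]
    rintro _ ⟨p, ⟨q, hq, hp, hp0⟩, rfl⟩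
    exact mem_eqsIdeal hq (hφ q p hp hp0).1 (hφ q p hp hp0).2
  exact h (Ideal.mem_map_of_mem φ hF)

theorem MvPolynomial.IsHomogeneous.aeval_mul [Algebra R S] {F : MvPolynomial σ R} {q : ℕ}
    (hF : F.IsHomogeneous q) (c : S) (v : σ → S) :
    MvPolynomial.aeval (fun i ↦ c * v i) F = c ^ q * MvPolynomial.aeval v F := by
  rw [MvPolynomial.aeval_def, MvPolynomial.aeval_def, MvPolynomial.eval₂_eq,
    MvPolynomial.eval₂_eq, Finset.mul_sum]
  refine Finset.sum_congr rfl fun d hd ↦ ?_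
  have hd' : ∑ i ∈ d.support, d i = q := (hF.degree_eq_sum_deg_support hd).symm
  simp only [mul_pow, Finset.prod_mul_distrib, Finset.prod_pow_eq_pow_sum, hd']
  ring

theorem aeval_C_mul_X {s : ℕ} (f : Fin s → R) {F : MvPolynomial (Fin s) R} {q : ℕ}
    (hF : F.IsHomogeneous q) :
    MvPolynomial.aeval (fun i ↦ Polynomial.C (f i) * Polynomial.X) F =
      Polynomial.X ^ q * Polynomial.C (MvPolynomial.eval f F) := by
  have h := hF.aeval_mul (S := Polynomial R) Polynomial.X (fun i ↦ Polynomial.C (f i))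
  have h' : MvPolynomial.aeval (fun i ↦ Polynomial.C (f i)) F =
      Polynomial.C (MvPolynomial.eval f F) :=
    MvPolynomial.aeval_algebraMap_apply (Polynomial R) f F
  simpa only [h', mul_comm Polynomial.X (Polynomial.C _)] using h

theorem mem_reesKer_iff_of_isHomogeneous {s : ℕ} (f : Fin s → R)
    {F : MvPolynomial (Fin s) R} {q : ℕ} (hF : F.IsHomogeneous q) :
    F ∈ reesKer f ↔ MvPolynomial.eval f F = 0 := by
  have h : F ∈ reesKer f ↔
      MvPolynomial.aeval (fun i ↦ Polynomial.C (f i) * Polynomial.X) F = 0 := Iff.rfl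
  rw [h, aeval_C_mul_X f hF]
  refine ⟨fun h ↦ ?_, fun h ↦ by simp [h]⟩
  simpa using congrArg (fun p ↦ p.coeff q) h

theorem homogeneousComponent_mem_reesKer {s : ℕ} (f : Fin s → R)
    {F : MvPolynomial (Fin s) R} (hF : F ∈ reesKer f) (q : ℕ) :
    MvPolynomial.homogeneousComponent q F ∈ reesKer f := by
  rw [mem_reesKer_iff_of_isHomogeneous f (MvPolynomial.homogeneousComponent_isHomogeneous q F)]
  have h : MvPolynomial.aeval (fun i ↦ Polynomial.C (f i) * Polynomial.X) F = 0 := hF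
  rw [← MvPolynomial.sum_homogeneousComponent F, map_sum] at h
  simp only [aeval_C_mul_X f (MvPolynomial.homogeneousComponent_isHomogeneous _ F)] at h
  have hq := congrArg (fun p ↦ p.coeff q) h
  simp only [Polynomial.finsetSum_coeff, Polynomial.coeff_X_pow_mul', Polynomial.coeff_C,
    Polynomial.coeff_zero] at hq
  by_cases hlt : F.totalDegree < q
  · rw [MvPolynomial.homogeneousComponent_eq_zero _ _ hlt, map_zero]
  · rw [Finset.sum_eq_single q] at hq
    · simpa using hq
    · intro i _ hi
      split_ifs <;> first | rfl | omega
    · intro hq'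
      simp at hq'
      omega

theorem genInDegLE_reesKer_iff {s : ℕ} (f : Fin s → R) (N : ℕ) :
    GenInDegLE (reesKer f) N ↔ EqsGenInDegLE f N := by
  have hset : {p | p ∈ reesKer f ∧ ∃ q ≤ N, MvPolynomial.IsHomogeneous p q} =
      {p | ∃ q ≤ N, p.IsHomogeneous q ∧ MvPolynomial.eval f p = 0} := by
    ext p
    constructor
    · rintro ⟨hp, q, hq, hpq⟩
      exact ⟨q, hq, hpq, (mem_reesKer_iff_of_isHomogeneous f hpq).1 hp⟩
    · rintro ⟨q, hq, hpq, hp⟩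
      exact ⟨(mem_reesKer_iff_of_isHomogeneous f hpq).2 hp, q, hq, hpq⟩
  have hle : eqsIdeal f N ≤ reesKer f := by
    rw [eqsIdeal, ← hset, Ideal.span_le]
    exact fun p hp ↦ hp.1
  have hgen : GenInDegLE (reesKer f) N ↔ reesKer f = eqsIdeal f N := by
    rw [GenInDegLE, hset, eqsIdeal]
  rw [hgen]
  constructor
  · intro h q F hF hF0
    rw [← h]
    exact (mem_reesKer_iff_of_isHomogeneous f hF).2 hF0
  · refine fun h ↦ le_antisymm (fun F hF ↦ ?_) hle
    rw [← MvPolynomial.sum_homogeneousComponent F]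
    refine Ideal.sum_mem _ fun q _ ↦ ?_
    have hq := MvPolynomial.homogeneousComponent_isHomogeneous q F
    exact h q _ hq
      ((mem_reesKer_iff_of_isHomogeneous f hq).1 (homogeneousComponent_mem_reesKer f hF q))

/-- If `a I ⊆ J` and `b J ⊆ I`, and the equations of `J` are generated in degree at most `N`,
then so are the equations of `I` after multiplication by a power of `a b`. -/
theorem EqsGenInDegLE.transfer [Fintype σ] [Fintype τ] {f : σ → R} {g : τ → R} {a b : R} {N : ℕ}
    (hg : EqsGenInDegLE g N) (hN : 1 ≤ N)
    (ha : ∀ i, a * f i ∈ Ideal.span (Set.range g))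
    (hb : ∀ j, b * g j ∈ Ideal.span (Set.range f))
    {q : ℕ} {F : MvPolynomial σ R} (hF : F.IsHomogeneous q) (hF0 : MvPolynomial.eval f F = 0) :
    MvPolynomial.C (a * b) ^ q * F ∈ eqsIdeal f N := by
  choose c hch hc using fun i ↦ (Ideal.mem_span_iff_exists_isHomogeneous g _).1 (ha i)
  choose d hdh hd using fun j ↦ (Ideal.mem_span_iff_exists_isHomogeneous f _).1 (hb j)
  have hF1 : MvPolynomial.aeval c F ∈ eqsIdeal g N := by
    refine hg q _ (by simpa using hF.aeval c hch) ?_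
    have h := hF.aeval_mul a f
    rw [MvPolynomial.aeval_eq_eval] at h
    rw [← MvPolynomial.aeval_eq_eval, MvPolynomial.comp_aeval_apply]
    simp only [MvPolynomial.aeval_eq_eval, hc]
    simpa [hF0] using h
  have heval : ∀ {r : ℕ} (p : MvPolynomial τ R), p.IsHomogeneous r →
      MvPolynomial.eval f (MvPolynomial.aeval d p) = b ^ r * MvPolynomial.eval g p := by
    intro r p hp
    have h := hp.aeval_mul b g
    rw [← MvPolynomial.aeval_eq_eval, MvPolynomial.comp_aeval_apply]
    simp only [MvPolynomial.aeval_eq_eval, hd]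
    simpa [MvPolynomial.aeval_eq_eval] using h
  have hF2 : MvPolynomial.aeval d (MvPolynomial.aeval c F) ∈ eqsIdeal f N := by
    refine map_mem_eqsIdeal (MvPolynomial.aeval d : MvPolynomial τ R →ₐ[R] _).toRingHom
      (fun r p hp hp0 ↦ ⟨by simpa using hp.aeval d hdh, ?_⟩) hF1
    simpa [hp0] using heval p hp
  let π := Ideal.Quotient.mkₐ R (eqsIdeal f N)
  have hlin : ∀ i, π (MvPolynomial.aeval d (c i)) =
      π (MvPolynomial.C (a * b)) * π (MvPolynomial.X i) := by
    intro i
    rw [← map_mul]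
    refine Ideal.Quotient.eq.2 (mem_eqsIdeal (q := 1) hN ?_ ?_)
    · exact (by simpa using (hch i).aeval d hdh : MvPolynomial.IsHomogeneous _ 1).sub
        (MvPolynomial.isHomogeneous_C_mul_X _ _)
    · rw [map_sub, heval _ (hch i), hc]
      simp
      ring
  have key : π (MvPolynomial.aeval d (MvPolynomial.aeval c F)) =
      π (MvPolynomial.C (a * b) ^ q * F) := by
    rw [MvPolynomial.comp_aeval_apply _ (MvPolynomial.aeval d),
      MvPolynomial.comp_aeval_apply _ π]
    simp only [hlin]
    rw [hF.aeval_mul, map_mul π, map_pow π, ← MvPolynomial.comp_aeval_apply _ π,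
      MvPolynomial.aeval_X_left_apply]
  have h0 : π (MvPolynomial.aeval d (MvPolynomial.aeval c F)) = 0 :=
    Ideal.Quotient.eq_zero_iff_mem.2 hF2
  exact Ideal.Quotient.eq_zero_iff_mem.1 (key.symm.trans h0)

/-- Membership in an ideal of polynomials can be tested locally on the coefficient ring. -/
theorem mem_of_forall_isMaximal {K : Ideal (MvPolynomial σ R)} {F : MvPolynomial σ R}
    (h : ∀ m : Ideal R, m.IsMaximal → ∃ a ∉ m, MvPolynomial.C a * F ∈ K) : F ∈ K := by
  let A : Ideal R := (K.colon {F}).comap MvPolynomial.C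
  have hA : A = ⊤ := by
    by_contra hne
    obtain ⟨m, hm, hle⟩ := Ideal.exists_le_maximal A hne
    obtain ⟨a, ham, ha⟩ := h m hm
    refine ham (hle ?_)
    simpa [A, Submodule.mem_colon_singleton] using ha
  have h1 : (1 : R) ∈ A := hA ▸ Submodule.mem_top
  simpa [A, Submodule.mem_colon_singleton] using h1

theorem eqsGenInDegLE_of_isEmpty [IsEmpty σ] (f : σ → R) (N : ℕ) : EqsGenInDegLE f N := by
  intro q F _ hF0
  obtain ⟨c, rfl⟩ := MvPolynomial.C_surjective σ F
  have hc : c = 0 := by simpa using hF0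
  simp [hc]

theorem exists_eq_sum_of_mem_span_pow_succ [Fintype σ] (f : σ → R) (q : ℕ) {w : R}
    (hw : w ∈ Ideal.span (Set.range f) ^ (q + 1)) :
    ∃ V : σ → MvPolynomial σ R, (∀ i, (V i).IsHomogeneous q) ∧
      w = ∑ i, f i * MvPolynomial.eval f (V i) := by
  rw [pow_succ, ← smul_eq_mul] at hw
  obtain ⟨a, ha, rfl⟩ := (Submodule.mem_ideal_smul_span_iff_exists_sum _ f w).1 hw
  choose V hV hVa using fun i ↦ (Ideal.mem_span_pow_iff_exists_isHomogeneous f (a i)).1 (ha i)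
  refine ⟨V, hV, ?_⟩
  rw [Finsupp.sum_fintype _ _ (by simp)]
  exact Finset.sum_congr rfl fun i _ ↦ by rw [hVa, smul_eq_mul, mul_comm]

/-- Splitting off the terms of a form which involve the variable `none`. -/
theorem exists_eq_rename_add_X_mul {q : ℕ} {F : MvPolynomial (Option σ) R}
    (hF : F.IsHomogeneous (q + 1)) :
    ∃ (P : MvPolynomial σ R) (G : MvPolynomial (Option σ) R), P.IsHomogeneous (q + 1) ∧
      G.IsHomogeneous q ∧ F = MvPolynomial.rename some P + MvPolynomial.X none * G := by
  let v : Option σ → MvPolynomial σ R := fun o ↦ o.elim 0 MvPolynomial.X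
  have hv : ∀ o, (v o).IsHomogeneous 1 := by
    rintro (_ | i)
    · exact MvPolynomial.isHomogeneous_zero _ _ _
    · exact MvPolynomial.isHomogeneous_X _ _
  have hP : (MvPolynomial.aeval v F).IsHomogeneous (q + 1) := by simpa using hF.aeval v hv
  let K : Ideal (MvPolynomial (Option σ) R) := Ideal.span {MvPolynomial.X none}
  have hmem : F - MvPolynomial.rename some (MvPolynomial.aeval v F) ∈ K := by
    have hcomp : (Ideal.Quotient.mkₐ R K).comp
        ((MvPolynomial.rename some).comp (MvPolynomial.aeval v)) = Ideal.Quotient.mkₐ R K := by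
      ext o
      rcases o with _ | i
      · have : Ideal.Quotient.mk K (MvPolynomial.X none) = 0 :=
          Ideal.Quotient.eq_zero_iff_mem.2 (Ideal.subset_span rfl)
        simp [v, this]
      · simp [v]
    exact Ideal.Quotient.eq.1 (DFunLike.congr_fun hcomp F).symm
  obtain ⟨G, hG⟩ := Ideal.mem_span_singleton'.1 hmem
  have hG' : MvPolynomial.X none * G =
      F - MvPolynomial.rename some (MvPolynomial.aeval v F) := by rw [← hG, mul_comm]
  refine ⟨_, G, hP, ?_, by rw [hG']; ring⟩
  have hXG : (MvPolynomial.X none * G).IsHomogeneous (q + 1) := by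
    rw [hG']
    exact hF.sub hP.rename_isHomogeneous
  intro d hd
  have h := hXG (d := Finsupp.single none 1 + d) (by rwa [MvPolynomial.coeff_X_mul])
  rw [map_add] at h
  rw [Finsupp.weight_single] at h
  simp at h
  omega

/-- Adjoining to `f` an element `h` which is a nonzerodivisor modulo all powers of the ideal
generated by `f` preserves linear type. -/
theorem EqsGenInDegLE.option_elim [Fintype σ] {f : σ → R} (hf : EqsGenInDegLE f 1) {h : R}
    (hh : ∀ (q : ℕ) (w : R), h * w ∈ Ideal.span (Set.range f) ^ q →
      w ∈ Ideal.span (Set.range f) ^ q) :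
    EqsGenInDegLE (fun o : Option σ ↦ o.elim h f) 1 := by
  generalize hg : (fun o : Option σ ↦ o.elim h f) = g
  have hgn : g none = h := by simp [← hg]
  have hgs : ∀ i, g (some i) = f i := by simp [← hg]
  have hren : ∀ P : MvPolynomial σ R,
      MvPolynomial.eval g (MvPolynomial.rename some P) = MvPolynomial.eval f P := by
    intro P
    rw [MvPolynomial.eval_rename, ← hg]
    rfl
  intro q
  induction q with
  | zero => exact fun F hF hF0 ↦ mem_eqsIdeal zero_le_one hF hF0
  | succ q ih =>
    intro F hF hF0
    obtain ⟨P, G, hP, hG, rfl⟩ := exists_eq_rename_add_X_mul hF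
    have hsum : MvPolynomial.eval f P + h * MvPolynomial.eval g G = 0 := by
      simpa [hren, hgn] using hF0
    have hPmem : MvPolynomial.eval f P ∈ Ideal.span (Set.range f) ^ (q + 1) :=
      (Ideal.mem_span_pow_iff_exists_isHomogeneous f _).2 ⟨P, hP, rfl⟩
    have hw : MvPolynomial.eval g G ∈ Ideal.span (Set.range f) ^ (q + 1) := by
      refine hh _ _ ?_
      rw [eq_neg_of_add_eq_zero_right hsum]
      exact neg_mem hPmem
    obtain ⟨V, hV, hVw⟩ := exists_eq_sum_of_mem_span_pow_succ f q hw
    let Q := P + MvPolynomial.C h * ∑ i, MvPolynomial.X i * V i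
    have hQ : Q ∈ eqsIdeal f 1 := by
      refine hf (q + 1) Q (hP.add (MvPolynomial.IsHomogeneous.C_mul
        (MvPolynomial.IsHomogeneous.sum _ _ _ fun i _ ↦ ?_) h)) ?_
      · rw [add_comm q 1]
        exact (MvPolynomial.isHomogeneous_X R i).mul (hV i)
      · simpa [Q, hVw] using hsum
    have hQ' : MvPolynomial.rename some Q ∈ eqsIdeal g 1 :=
      map_mem_eqsIdeal (MvPolynomial.rename some : MvPolynomial σ R →ₐ[R] _).toRingHom
        (fun r p hp hp0 ↦ ⟨hp.rename_isHomogeneous, (hren p).trans hp0⟩) hQ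
    let G' := G - ∑ i, MvPolynomial.C (f i) * MvPolynomial.rename some (V i)
    have hG' : G' ∈ eqsIdeal g 1 := by
      refine ih G' (hG.sub (MvPolynomial.IsHomogeneous.sum _ _ _ fun i _ ↦
        MvPolynomial.IsHomogeneous.C_mul (hV i).rename_isHomogeneous _)) ?_
      simp [G', hren, hVw]
    have hK : ∑ i, MvPolynomial.rename some (V i) * (MvPolynomial.C h * MvPolynomial.X (some i) -
        MvPolynomial.C (f i) * MvPolynomial.X none) ∈ eqsIdeal g 1 := by
      refine Ideal.sum_mem _ fun i _ ↦ Ideal.mul_mem_left _ _ (mem_eqsIdeal le_rfl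
        ((MvPolynomial.isHomogeneous_C_mul_X _ _).sub
          (MvPolynomial.isHomogeneous_C_mul_X _ _)) ?_)
      simp [hgn, hgs]
      ring
    have hdecomp : MvPolynomial.rename some P + MvPolynomial.X none * G =
        MvPolynomial.rename some Q - (∑ i, MvPolynomial.rename some (V i) *
          (MvPolynomial.C h * MvPolynomial.X (some i) -
            MvPolynomial.C (f i) * MvPolynomial.X none)) + MvPolynomial.X none * G' := by
      simp only [Q, G', map_add, map_mul, map_sum, MvPolynomial.rename_C, MvPolynomial.rename_X,
        mul_sub, Finset.sum_sub_distrib, Finset.mul_sum]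
      have e1 : ∀ i, MvPolynomial.rename some (V i) *
          (MvPolynomial.C h * MvPolynomial.X (some i)) =
          MvPolynomial.C h * (MvPolynomial.X (some i) * MvPolynomial.rename some (V i)) :=
        fun i ↦ by ring
      have e2 : ∀ i, MvPolynomial.rename some (V i) *
          (MvPolynomial.C (f i) * MvPolynomial.X none) =
          MvPolynomial.X none * (MvPolynomial.C (f i) * MvPolynomial.rename some (V i)) :=
        fun i ↦ by ring
      simp only [e1, e2]
      ring
    rw [hdecomp]
    exact add_mem (sub_mem hQ' hK) (Ideal.mul_mem_left _ _ hG')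

theorem EqsGenInDegLE.map_ringEquiv {f : σ → R} {N : ℕ} (hf : EqsGenInDegLE f N) (e : R ≃+* S) :
    EqsGenInDegLE (fun i ↦ e (f i)) N := by
  intro q F hF hF0
  have h1 : MvPolynomial.map (e.symm : S →+* R) F ∈ eqsIdeal f N := by
    refine hf q _ (hF.map _) ?_
    have h := congrArg e.symm hF0
    rw [map_zero] at h
    rw [← h, MvPolynomial.eval_map, MvPolynomial.eval, MvPolynomial.coe_eval₂Hom]
    have := MvPolynomial.hom_eval₂ F (RingHom.id S) (e.symm : S →+* R) (fun i ↦ e (f i))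
    simpa [Function.comp_def] using this.symm
  have h2 := map_mem_eqsIdeal (g := fun i ↦ e (f i)) (MvPolynomial.map (e : R →+* S))
    (fun r p hp hp0 ↦ ⟨hp.map _, ?_⟩) h1
  · simpa [MvPolynomial.map_map, MvPolynomial.map_id] using h2
  · have := MvPolynomial.map_eval (e : R →+* S) f p
    simpa [hp0, Function.comp_def] using this.symm

theorem EqsGenInDegLE.polynomial_C {f : σ → R} {N : ℕ} (hf : EqsGenInDegLE f N) :
    EqsGenInDegLE (fun i ↦ Polynomial.C (f i)) N := by
  intro q F hF hF0
  let c : ℕ → MvPolynomial σ R := fun j ↦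
    ∑ d ∈ F.support, MvPolynomial.monomial d ((F.coeff d).coeff j)
  have hc : ∀ j d, (c j).coeff d = (F.coeff d).coeff j := by
    classical
    intro j d
    simp only [c, MvPolynomial.coeff_sum, MvPolynomial.coeff_monomial, Finset.sum_ite_eq']
    split_ifs with hd
    · rfl
    · rw [MvPolynomial.notMem_support_iff.1 hd, Polynomial.coeff_zero]
  have hhom : ∀ j, (c j).IsHomogeneous q := by
    intro j
    refine MvPolynomial.IsHomogeneous.sum _ _ _ fun d hd ↦
      MvPolynomial.isHomogeneous_monomial _ ?_
    by_contra hne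
    exact MvPolynomial.mem_support_iff.1 hd (hF.coeff_eq_zero hne)
  have heval : ∀ j, MvPolynomial.eval f (c j) = 0 := by
    intro j
    have h := congrArg (fun p ↦ p.coeff j) hF0
    simp only [MvPolynomial.eval_eq, Polynomial.finsetSum_coeff,
      ← Polynomial.C_pow, ← map_prod, Polynomial.coeff_mul_C, Polynomial.coeff_zero] at h
    simpa only [c, map_sum, MvPolynomial.eval_monomial, Finsupp.prod] using h
  have hmem : ∀ j, MvPolynomial.map Polynomial.C (c j) ∈
      eqsIdeal (fun i ↦ Polynomial.C (f i)) N := by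
    intro j
    refine map_mem_eqsIdeal (MvPolynomial.map Polynomial.C) (fun r p hp hp0 ↦ ⟨hp.map _, ?_⟩)
      (hf q _ (hhom j) (heval j))
    have := MvPolynomial.map_eval Polynomial.C f p
    simpa [hp0, Function.comp_def] using this.symm
  let M := F.support.sup fun d ↦ (F.coeff d).natDegree
  have hF' : F = ∑ j ∈ Finset.range (M + 1),
      MvPolynomial.C (Polynomial.X ^ j) * MvPolynomial.map Polynomial.C (c j) := by
    ext1 d
    simp only [MvPolynomial.coeff_sum, MvPolynomial.coeff_C_mul, MvPolynomial.coeff_map, hc]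
    have hd : (F.coeff d).natDegree < M + 1 := by
      by_cases hd : d ∈ F.support
      · exact Nat.lt_succ_of_le (Finset.le_sup (f := fun d ↦ (F.coeff d).natDegree) hd)
      · simp [MvPolynomial.notMem_support_iff.1 hd]
    conv_lhs => rw [(F.coeff d).as_sum_range_C_mul_X_pow' hd]
    exact Finset.sum_congr rfl fun j _ ↦ mul_comm _ _
  rw [hF']
  exact Ideal.sum_mem _ fun j _ ↦ Ideal.mul_mem_left _ _ (hmem j)

theorem Polynomial.Monic.mem_map_C_of_mul_mem_s11 {I : Ideal R} {h w : Polynomial R} (hh : h.Monic)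
    (hw : h * w ∈ I.map Polynomial.C) : w ∈ I.map Polynomial.C := by
  have hker : ∀ p : Polynomial R, p ∈ I.map Polynomial.C ↔
      Polynomial.map (Ideal.Quotient.mk I) p = 0 := by
    intro p
    have := Polynomial.ker_mapRingHom (Ideal.Quotient.mk I)
    rw [Ideal.mk_ker] at this
    rw [← this]
    rfl
  rw [hker] at hw ⊢
  rw [Polynomial.map_mul] at hw
  exact ((hh.map _).mul_right_eq_zero_iff).1 hw

theorem exists_eqsGenInDegLE_polynomial [IsJacobsonRing R] (m : Ideal (Polynomial R))
    [hm : m.IsMaximal]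
    (h : ∀ p : Ideal R, p.IsMaximal → ∃ (ι : Type) (_ : Fintype ι) (f : ι → R),
      Ideal.span (Set.range f) = p ∧ EqsGenInDegLE f 1) :
    ∃ (ι : Type) (_ : Fintype ι) (f : ι → Polynomial R),
      Ideal.span (Set.range f) = m ∧ EqsGenInDegLE f 1 := by
  have hp := Polynomial.isMaximal_comap_C_of_isJacobsonRing m
  have hne : m ≠ (m.comap Polynomial.C).map Polynomial.C := by
    intro heq
    have hX : (Polynomial.X : Polynomial R) ∉ m := by
      intro hX
      rw [heq, Ideal.mem_map_C_iff] at hX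
      exact hp.ne_top ((Ideal.eq_top_iff_one _).2 (by simpa using hX 1))
    obtain ⟨y, z, hz, hyz⟩ := hm.exists_inv hX
    rw [heq, Ideal.mem_map_C_iff] at hz
    refine hp.ne_top ((Ideal.eq_top_iff_one _).2 ?_)
    have h0 := hz 0
    rw [eq_sub_of_add_eq' hyz] at h0
    simpa using h0
  obtain ⟨g, hg, hmg⟩ := Polynomial.exists_monic_span_sup_map_eq R m hp hne
  obtain ⟨ι, _, f, hfp, hf⟩ := h _ hp
  have hspan : Ideal.span (Set.range fun i ↦ Polynomial.C (f i)) =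
      (m.comap Polynomial.C).map Polynomial.C := by
    rw [← hfp, Ideal.map_span, ← Set.range_comp]
    rfl
  refine ⟨Option ι, inferInstance, fun o ↦ o.elim g fun i ↦ Polynomial.C (f i), ?_,
    hf.polynomial_C.option_elim fun q w hw ↦ ?_⟩
  · have hr : Set.range (fun o : Option ι ↦ o.elim g fun i ↦ Polynomial.C (f i)) =
        insert g (Set.range fun i ↦ Polynomial.C (f i)) := by
      ext; simp [Option.exists, eq_comm]
    rw [hr, Ideal.span_insert, hspan, sup_comm, ← hmg]
  · rw [hspan, ← Ideal.map_pow] at hw ⊢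
    exact hg.mem_map_C_of_mul_mem_s11 hw

/-- Maximal ideals of polynomial rings over a field are of linear type. -/
theorem exists_eqsGenInDegLE_of_isMaximal {k : Type*} [Field k] (n : ℕ)
    (m : Ideal (MvPolynomial (Fin n) k)) (hm : m.IsMaximal) :
    ∃ (ι : Type) (_ : Fintype ι) (f : ι → MvPolynomial (Fin n) k),
      Ideal.span (Set.range f) = m ∧ EqsGenInDegLE f 1 := by
  induction n with
  | zero =>
    refine ⟨Empty, inferInstance, Empty.elim, ?_, eqsGenInDegLE_of_isEmpty _ _⟩
    have hfield : IsField (MvPolynomial (Fin 0) k) :=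
      (MvPolynomial.isEmptyRingEquiv k (Fin 0)).toMulEquiv.isField (Field.toIsField k)
    have hbot : m = ⊥ := by
      let := hfield.toField
      exact (Ideal.eq_bot_or_top m).resolve_right hm.ne_top
    simp [hbot]
  | succ n ih =>
    let e : MvPolynomial (Fin (n + 1)) k ≃+* Polynomial (MvPolynomial (Fin n) k) :=
      (MvPolynomial.finSuccEquiv k n).toRingEquiv
    let φ : Polynomial (MvPolynomial (Fin n) k) →+* MvPolynomial (Fin (n + 1)) k := e.symm
    have hφ : Function.Surjective φ := e.symm.surjective
    have hm' : (m.comap φ).IsMaximal :=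
      Ideal.comap_isMaximal_of_surjective φ hφ
    obtain ⟨ι, _, f, hfm, hf⟩ := exists_eqsGenInDegLE_polynomial (m.comap φ) ih
    refine ⟨ι, inferInstance, fun i ↦ e.symm (f i), ?_, hf.map_ringEquiv e.symm⟩
    have h := congrArg (Ideal.map φ) hfm
    rw [Ideal.map_span, ← Set.range_comp,
      Ideal.map_comap_of_surjective φ hφ] at h
    exact h

theorem relType_eq_of_forall {I J : Ideal R}
    (h : ∀ N, 1 ≤ N → ((∀ (s : ℕ) (f : Fin s → R),
        Ideal.span (Set.range f) = I → EqsGenInDegLE f N) ↔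
      ∀ (s : ℕ) (f : Fin s → R), Ideal.span (Set.range f) = J → EqsGenInDegLE f N)) :
    relType I = relType J := by
  simp only [relType, genInDegLE_reesKer_iff]
  congr 1
  ext N
  exact and_congr_right (h N)

/-- If `I` is locally, up to multiplication by elements outside each maximal ideal, equal to an
ideal whose equations are generated in degree at most `N`, then the same holds for `I`. -/
theorem EqsGenInDegLE.of_forall_isMaximal [Fintype σ] {f : σ → R} {N : ℕ} (hN : 1 ≤ N)
    (h : ∀ m : Ideal R, m.IsMaximal → ∃ (ι : Type) (_ : Fintype ι) (g : ι → R),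
      EqsGenInDegLE g N ∧ ∃ a ∉ m, ∃ b ∉ m,
        (∀ x ∈ Ideal.span (Set.range f), a * x ∈ Ideal.span (Set.range g)) ∧
        ∀ x ∈ Ideal.span (Set.range g), b * x ∈ Ideal.span (Set.range f)) :
    EqsGenInDegLE f N := by
  intro q F hF hF0
  refine mem_of_forall_isMaximal fun m hm ↦ ?_
  obtain ⟨ι, _, g, hg, a, ha, b, hb, hab, hba⟩ := h m hm
  refine ⟨(a * b) ^ q, fun hmem ↦ ?_, ?_⟩
  · exact (hm.isPrime.mem_or_mem (hm.isPrime.mem_of_pow_mem q hmem)).elim ha hb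
  · rw [map_pow]
    exact hg.transfer hN (fun i ↦ hab _ (Ideal.subset_span ⟨i, rfl⟩))
      (fun j ↦ hba _ (Ideal.subset_span ⟨j, rfl⟩)) hF hF0

theorem exists_notMem_forall_mem_of_ne {r : ℕ} (𝔪 : Fin r → Ideal R) (hmax : ∀ j, (𝔪 j).IsMaximal)
    {m : Ideal R} (hm : m.IsMaximal) : ∃ b ∉ m, ∀ j, 𝔪 j ≠ m → b ∈ 𝔪 j := by
  classical
  have h : ¬ (Finset.univ.filter fun j ↦ 𝔪 j ≠ m).inf 𝔪 ≤ m := by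
    rw [hm.isPrime.inf_le']
    rintro ⟨j, hj, hle⟩
    exact (Finset.mem_filter.1 hj).2 ((hmax j).eq_of_le hm.ne_top hle)
  obtain ⟨b, hb, hbm⟩ := Set.not_subset.1 h
  refine ⟨b, hbm, fun j hj ↦ ?_⟩
  exact Finset.inf_le (f := 𝔪) (Finset.mem_filter.2 ⟨Finset.mem_univ j, hj⟩) hb

end RelationType

/-- If `J` is a proper ideal of `R = k[x₁,…,xₙ]` and `𝔪₁,…,𝔪_r` are maximal ideals of `R` with
`J ⊄ 𝔪ⱼ` for each `j`, then `rt(J ∩ 𝔪₁ ∩ … ∩ 𝔪_r) = rt(J)`. -/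
theorem relType_inf_maximals {k : Type*} [Field k] {n : ℕ}
    (J : Ideal (MvPolynomial (Fin n) k)) (hJ : J ≠ ⊤) {r : ℕ}
    (𝔪 : Fin r → Ideal (MvPolynomial (Fin n) k)) (hmax : ∀ j, (𝔪 j).IsMaximal)
    (hJm : ∀ j, ¬ J ≤ 𝔪 j) :
    relType (J ⊓ ⨅ j, 𝔪 j) = relType J := by
  have hfg : ∀ I : Ideal (MvPolynomial (Fin n) k), ∃ (s : ℕ) (f : Fin s → _),
      Ideal.span (Set.range f) = I := fun I ↦
    Submodule.fg_iff_exists_fin_generating_family.1 (IsNoetherian.noetherian I)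
  have hmulJ : ∀ {a b : MvPolynomial (Fin n) k} {m : Ideal (MvPolynomial (Fin n) k)},
      (∀ j, 𝔪 j ≠ m → b ∈ 𝔪 j) → a ∈ m → a ∈ J → b * a ∈ J ⊓ ⨅ j, 𝔪 j := by
    intro a b m hb ha haJ
    refine ⟨J.mul_mem_left _ haJ, (Ideal.mem_iInf).2 fun j ↦ ?_⟩
    by_cases hj : 𝔪 j = m
    · exact Ideal.mul_mem_left _ _ (hj ▸ ha)
    · exact Ideal.mul_mem_right _ _ (hb j hj)
  have hmul : ∀ {m : Ideal (MvPolynomial (Fin n) k)} {b : MvPolynomial (Fin n) k}, (∀ j, 𝔪 j ≠ m) →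
      (∀ j, 𝔪 j ≠ m → b ∈ 𝔪 j) → ∀ x ∈ J, b * x ∈ J ⊓ ⨅ j, 𝔪 j := by
    intro m b hm hb x hx
    exact Ideal.mem_inf.2 ⟨J.mul_mem_left _ hx,
      Ideal.mem_iInf.2 fun j ↦ Ideal.mul_mem_right _ _ (hb j (hm j))⟩
  refine relType_eq_of_forall fun N hN ↦ ⟨fun h s g hg ↦ ?_, fun h s f hf ↦ ?_⟩
  · refine EqsGenInDegLE.of_forall_isMaximal hN fun m hm ↦ ?_
    rw [hg]
    by_cases hjm : ∃ j, 𝔪 j = m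
    · obtain ⟨j, rfl⟩ := hjm
      obtain ⟨b, hbJ, hb⟩ := Set.not_subset.1 (hJm j)
      refine ⟨Option Empty, inferInstance, fun o ↦ o.elim 1 Empty.elim,
        ((eqsGenInDegLE_of_isEmpty _ 1).option_elim fun q w hw ↦ by simpa using hw).mono hN,
        1, (Ideal.ne_top_iff_one _).1 hm.ne_top, b, hb, fun x _ ↦ ?_,
        fun x _ ↦ J.mul_mem_right _ hbJ⟩
      exact Ideal.mul_mem_right _ _ (Ideal.subset_span ⟨none, rfl⟩)
    · obtain ⟨t, f, hf⟩ := hfg (J ⊓ ⨅ j, 𝔪 j)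
      obtain ⟨b, hbm, hb⟩ := exists_notMem_forall_mem_of_ne 𝔪 hmax hm
      refine ⟨Fin t, inferInstance, f, h t f hf, b, hbm, 1,
        (Ideal.ne_top_iff_one _).1 hm.ne_top, ?_, fun x hx ↦ ?_⟩
      · rw [hf]
        exact hmul (not_exists.1 hjm) hb
      · rw [hf] at hx
        rw [one_mul]
        exact hx.1
  · refine EqsGenInDegLE.of_forall_isMaximal hN fun m hm ↦ ?_
    rw [hf]
    obtain ⟨b, hbm, hb⟩ := exists_notMem_forall_mem_of_ne 𝔪 hmax hm
    by_cases hjm : ∃ j, 𝔪 j = m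
    · obtain ⟨j, rfl⟩ := hjm
      obtain ⟨c, hcJ, hc⟩ := Set.not_subset.1 (hJm j)
      obtain ⟨ι, _, g, hgm, hg⟩ := exists_eqsGenInDegLE_of_isMaximal n (𝔪 j) hm
      refine ⟨ι, inferInstance, g, hg.mono hN, 1, (Ideal.ne_top_iff_one _).1 hm.ne_top,
        b * c, fun hbc ↦ (hm.isPrime.mem_or_mem hbc).elim hbm hc, fun x hx ↦ ?_, fun x hx ↦ ?_⟩
      · rw [one_mul, hgm]
        exact Ideal.mem_iInf.1 hx.2 j
      · rw [hgm] at hx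
        rw [mul_assoc]
        exact hmulJ hb (Ideal.mul_mem_left _ _ hx) (Ideal.mul_mem_right _ _ hcJ)
    · obtain ⟨t, g, hg⟩ := hfg J
      refine ⟨Fin t, inferInstance, g, h t g hg, 1, (Ideal.ne_top_iff_one _).1 hm.ne_top,
        b, hbm, fun x hx ↦ ?_, ?_⟩
      · rw [one_mul, hg]
        exact hx.1
      · rw [hg]
        exact hmul (not_exists.1 hjm) hb
end
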